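/- arXiv:math-ph/0008013 — 10 statements merged into one kernel-verified Lean document; each statement's English description precedes it below -/
import Mathlib

section
/- There exist c ∈ ℝ, n ∈ ℕ, pairwise distinct reals ε_1, …, ε_n and strictly positive reals w_1, …, w_n such that for every z ∈ ℂ ∖ ℝ one has −1/m(z) = z + c + Σ_{j=1}^n w_j/(ε_j − z). -/
open scoped InnerProductSpace

/-- A finite sum of simple fractions with nonnegative weights can be rewritten with distinct poles
and positive weights. -/
theorem exists_injective_pos_sum_div {ι : Type*} [Fintype ι] (β a : ι → ℝ) (ha : ∀ i, 0 ≤ a i) :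
    ∃ (n : ℕ) (ε w : Fin n → ℝ), Function.Injective ε ∧ (∀ j, 0 < w j) ∧
      ∀ z : ℂ, ∑ i, (a i : ℂ) / ((β i : ℂ) - z) = ∑ j, (w j : ℂ) / ((ε j : ℂ) - z) := by
  classical
  let T : Finset ι := {i | 0 < a i}
  let S : Finset ℝ := T.image β
  let W : ℝ → ℝ := fun x => ∑ i ∈ T with β i = x, a i
  refine ⟨S.card, fun j => (S.equivFin.symm j : ℝ), fun j => W (S.equivFin.symm j),
    Subtype.val_injective.comp S.equivFin.symm.injective, fun j => ?_, fun z => ?_⟩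
  · obtain ⟨i, hi, hij⟩ := Finset.mem_image.1 (S.equivFin.symm j).2
    refine Finset.sum_pos (fun k hk => ?_) ⟨i, Finset.mem_filter.2 ⟨hi, hij⟩⟩
    exact (Finset.mem_filter.1 (Finset.mem_filter.1 hk).1).2
  · rw [S.equivFin.symm.sum_comp (fun x : S => (W x : ℂ) / (((x : ℝ) : ℂ) - z)),
      Finset.sum_coe_sort S (fun x : ℝ => (W x : ℂ) / ((x : ℂ) - z))]
    have hT : ∑ i, (a i : ℂ) / ((β i : ℂ) - z) = ∑ i ∈ T, (a i : ℂ) / ((β i : ℂ) - z) := by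
      refine (Finset.sum_subset (Finset.subset_univ T) fun i _ hi => ?_).symm
      have h : a i = 0 := le_antisymm (by simpa [T] using hi) (ha i)
      simp [h]
    rw [hT, ← Finset.sum_fiberwise_of_maps_to (fun i hi => Finset.mem_image_of_mem β hi)]
    refine Finset.sum_congr rfl fun x _ => ?_
    simp only [W, Complex.ofReal_sum, Finset.sum_div]
    refine Finset.sum_congr rfl fun i hi => ?_
    rw [(Finset.mem_filter.1 hi).2]

/-- Every subspace has an orthonormal basis diagonalizing the compression
of a given symmetric operator. -/
theorem exists_orthonormalBasis_compression {V : Type*} [NormedAddCommGroup V]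
    [InnerProductSpace ℂ V] [FiniteDimensional ℂ V] (A : V →ₗ[ℂ] V) (hA : A.IsSymmetric)
    (K : Submodule ℂ V) :
    ∃ (n : ℕ) (e : OrthonormalBasis (Fin n) ℂ K) (β : Fin n → ℝ),
      ∀ k i, ⟪(e k : V), A (e i)⟫_ℂ = if k = i then (β i : ℂ) else 0 := by
  let B : K →ₗ[ℂ] K := K.orthogonalProjectionOnto.toLinearMap ∘ₗ A ∘ₗ K.subtype
  have hB : B.IsSymmetric := fun x y => by
    simpa [B] using hA x y
  refine ⟨_, hB.eigenvectorBasis rfl, hB.eigenvalues rfl, fun k i => ?_⟩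
  have hBA : ∀ x y : K, ⟪x, B y⟫_ℂ = ⟪(x : V), A y⟫_ℂ := fun x y => by simp [B]
  have h := congrArg (fun x => ⟪hB.eigenvectorBasis rfl k, x⟫_ℂ) (hB.apply_eigenvectorBasis rfl i)
  simp only [inner_smul_right, OrthonormalBasis.inner_eq_ite] at h
  rw [← hBA, h]
  simp

/-- The Schur complement formula for a diagonal resolvent entry. -/
theorem inner_inverse_sub_smul_inv_eq {V ι : Type*} [NormedAddCommGroup V]
    [InnerProductSpace ℂ V] [Fintype ι] [DecidableEq ι]
    (A : V →L[ℂ] V) (hA : A.toLinearMap.IsSymmetric) (φ : V) (hφ : ‖φ‖ = 1)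
    (e : OrthonormalBasis ι ℂ (ℂ ∙ φ)ᗮ) (β : ι → ℝ)
    (he : ∀ k i, ⟪(e k : V), A (e i)⟫_ℂ = if k = i then (β i : ℂ) else 0)
    (z : ℂ) (hz : z.im ≠ 0) (hu : IsUnit (A - z • 1)) :
    (⟪φ, Ring.inverse (A - z • 1) φ⟫_ℂ)⁻¹ =
      ⟪φ, A φ⟫_ℂ - z - ∑ i, ((‖⟪(e i : V), A φ⟫_ℂ‖ ^ 2 : ℝ) : ℂ) / ((β i : ℂ) - z) := by
  set s : ℂ :=
    ⟪φ, A φ⟫_ℂ - z - ∑ i, ((‖⟪(e i : V), A φ⟫_ℂ‖ ^ 2 : ℝ) : ℂ) / ((β i : ℂ) - z) with hs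
  set c : ι → ℂ := fun i => ⟪(e i : V), A φ⟫_ℂ / ((β i : ℂ) - z) with hc
  set u : V := φ - ∑ i, c i • (e i : V) with hu'
  have hβ : ∀ i, (β i : ℂ) - z ≠ 0 := fun i h => hz (by simpa using congrArg Complex.im h)
  have hφφ : ⟪φ, φ⟫_ℂ = 1 := by simp [inner_self_eq_norm_sq_to_K, hφ]
  have hφe : ∀ i, ⟪φ, (e i : V)⟫_ℂ = 0 := fun i =>
    Submodule.mem_orthogonal_singleton_iff_inner_right.1 (e i).2
  have heφ : ∀ i, ⟪(e i : V), φ⟫_ℂ = 0 := fun i =>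
    Submodule.mem_orthogonal_singleton_iff_inner_left.1 (e i).2
  have hee : ∀ k i, ⟪(e k : V), (e i : V)⟫_ℂ = if k = i then 1 else 0 := fun k i => by
    rw [← Submodule.coe_inner, e.inner_eq_ite]
  have hφA : ∀ i, ⟪φ, A (e i)⟫_ℂ = starRingEnd ℂ ⟪(e i : V), A φ⟫_ℂ := fun i => by
    rw [inner_conj_symm]; exact (hA φ (e i)).symm
  have hAu : (A - z • 1) u = s • φ := by
    have h1 : ⟪φ, (A - z • 1) u - s • φ⟫_ℂ = 0 := by
      simp only [hu', sub_apply, smul_apply,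
        one_apply_eq_self, map_sub, map_sum, map_smul, inner_sub_right, inner_sum,
        inner_smul_right, hφφ, hφe, hφA, smul_sub, hs,
        Finset.sum_sub_distrib, mul_zero, Finset.sum_const_zero]
      have h2 : ∀ i, c i * starRingEnd ℂ ⟪(e i : V), A φ⟫_ℂ =
          ((‖⟪(e i : V), A φ⟫_ℂ‖ ^ 2 : ℝ) : ℂ) / ((β i : ℂ) - z) := fun i => by
        rw [hc, div_mul_eq_mul_div, Complex.mul_conj, Complex.normSq_eq_norm_sq]
      simp only [h2]
      ring
    have h3 : ∀ k, ⟪(e k : V), (A - z • 1) u - s • φ⟫_ℂ = 0 := fun k => by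
      have h4 : c k * ((β k : ℂ) - z) = ⟪(e k : V), A φ⟫_ℂ := div_mul_cancel₀ _ (hβ k)
      simp only [hu', sub_apply, smul_apply,
        one_apply_eq_self, map_sub, map_sum, map_smul, inner_sub_right, inner_sum,
        inner_smul_right, heφ, hee, he, smul_sub, mul_zero, mul_ite, mul_one,
        Finset.sum_sub_distrib, Finset.sum_ite_eq, Finset.mem_univ, if_true]
      linear_combination -h4
    have hmem := Submodule.mem_orthogonal_singleton_iff_inner_right.2 h1
    have h5 : (⟨_, hmem⟩ : (ℂ ∙ φ)ᗮ) = 0 := by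
      rw [← e.sum_repr' ⟨_, hmem⟩]
      refine Finset.sum_eq_zero fun k _ => ?_
      rw [Submodule.coe_inner, h3 k, zero_smul]
    exact sub_eq_zero.1 (congrArg Subtype.val h5)
  have h6 : u = s • Ring.inverse (A - z • 1) φ := by
    rw [← map_smul, ← hAu, ← mul_apply_eq_comp, Ring.inverse_mul_cancel _ hu,
      one_apply_eq_self]
  have h7 : ⟪φ, u⟫_ℂ = 1 := by
    rw [hu', inner_sub_right, inner_sum, hφφ]
    simp [inner_smul_right, hφe]
  rw [h6, inner_smul_right] at h7
  exact (eq_inv_of_mul_eq_one_left h7).symm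

/-- Let `V` be a nonzero finite-dimensional complex inner product
space, `A` a self-adjoint operator on `V`, and `φ ∈ V` a unit vector.  For
`z ∈ ℂ ∖ σ(A)` set `m(z) = ⟪φ, (A − z)⁻¹ φ⟫` (below the resolvent is expressed as
`Ring.inverse (A - z • 1)`, which agrees with `(A - z)⁻¹` for `z ∉ σ(A)`, in particular
for all nonreal `z`).  Then there exist `c ∈ ℝ`, `n ∈ ℕ`, pairwise distinct reals
`ε_1, …, ε_n` and strictly positive reals `w_1, …, w_n` such that for every nonreal `z`,
`−1/m(z) = z + c + Σ_{j=1}^n w_j/(ε_j − z)`. -/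
theorem statement1
    {V : Type*} [NormedAddCommGroup V] [InnerProductSpace ℂ V]
    [FiniteDimensional ℂ V] [Nontrivial V]
    (A : V →L[ℂ] V) (hA : IsSelfAdjoint A)
    (φ : V) (hφ : ‖φ‖ = 1) :
    ∃ (c : ℝ) (n : ℕ) (ε : Fin n → ℝ) (w : Fin n → ℝ),
      Function.Injective ε ∧ (∀ j, 0 < w j) ∧
      ∀ z : ℂ, z.im ≠ 0 →
        -(⟪φ, (Ring.inverse (A - z • 1)) φ⟫_ℂ)⁻¹
          = z + (c : ℂ) + ∑ j, (w j : ℂ) / ((ε j : ℂ) - z) := by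
  have hsym : A.toLinearMap.IsSymmetric := hA.isSymmetric
  obtain ⟨N, e, β, he⟩ := exists_orthonormalBasis_compression A.toLinearMap hsym (ℂ ∙ φ)ᗮ
  obtain ⟨n, ε, w, hε, hw, hsum⟩ := exists_injective_pos_sum_div β
    (fun i => ‖⟪(e i : V), A φ⟫_ℂ‖ ^ 2) (fun i => by positivity)
  refine ⟨-(⟪φ, A φ⟫_ℂ).re, n, ε, w, hε, hw, fun z hz => ?_⟩
  have hre : (((⟪φ, A φ⟫_ℂ).re : ℝ) : ℂ) = ⟪φ, A φ⟫_ℂ :=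
    Complex.conj_eq_iff_re.1 (by rw [inner_conj_symm]; exact hsym φ φ)
  have hu : IsUnit (A - z • 1) := by
    by_contra h
    have hmem : z ∈ spectrum ℂ A := fun h' => h (by
      rw [← neg_sub, IsUnit.neg_iff, ← Algebra.algebraMap_eq_smul_one]; exact h')
    exact hz (by rw [hA.mem_spectrum_eq_re hmem, Complex.ofReal_im])
  rw [inner_inverse_sub_smul_inv_eq A hsym φ hφ e β he z hz hu, hsum z, Complex.ofReal_neg, hre]
  ring
end

section
/- For every x ∈ Γ and every z ∈ ℂ ∖ ℝ, both z ∉ σ(H) and γ(z) ∉ σ(H_o), and ⟨δ_{(x,O)}, (H − z)⁻¹ δ_{(x,O)}⟩ = ⟨δ_x, (H_o − γ(z))⁻¹ δ_x⟩. -/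
open scoped InnerProductSpace

/-- The pullback of a square-summable function along an injective map. -/
noncomputable def lpCompCLM {α β : Type*} (f : α → β) (hf : Function.Injective f) :
    lp (fun _ : β => ℂ) 2 →L[ℂ] lp (fun _ : α => ℂ) 2 :=
  LinearMap.mkContinuous
    { toFun := fun ψ => ⟨fun a => ψ (f a),
        memℓp_gen (((lp.memℓp ψ).summable (by norm_num)).comp_injective hf)⟩
      map_add' := fun _ _ => rfl
      map_smul' := fun _ _ => rfl }
    1 fun ψ => by
      have h2 : 0 < (2 : ENNReal).toReal := by norm_num
      refine lp.norm_le_of_tsum_le h2 (by positivity) ?_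
      rw [one_mul, lp.norm_rpow_eq_tsum h2]
      exact tsum_comp_le_tsum_of_inj ((lp.memℓp ψ).summable h2) (fun _ => by positivity) hf

@[simp]
lemma lpCompCLM_apply {α β : Type*} (f : α → β) (hf : Function.Injective f)
    (ψ : lp (fun _ : β => ℂ) 2) (a : α) : lpCompCLM f hf ψ a = ψ (f a) := rfl

lemma lp_clm_ext {α F : Type*} [DecidableEq α] [AddCommMonoid F] [Module ℂ F]
    [TopologicalSpace F] [T2Space F] {S T : lp (fun _ : α => ℂ) 2 →L[ℂ] F}
    (h : ∀ a, S (lp.single 2 a 1) = T (lp.single 2 a 1)) : S = T :=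
  lp.ext_continuousLinearMap (by norm_num) fun a =>
    ContinuousLinearMap.ext_ring (by simpa using h a)

lemma lp_inner_single_one {α : Type*} [DecidableEq α] (a : α) (ψ : lp (fun _ : α => ℂ) 2) :
    ⟪lp.single 2 a (1 : ℂ), ψ⟫_ℂ = ψ a := by
  rw [lp.inner_single_left]; simp

lemma IsSelfAdjoint.notMem_spectrum_of_im_ne_zero {E : Type*} [NormedAddCommGroup E]
    [InnerProductSpace ℂ E] [CompleteSpace E] {B : E →L[ℂ] E} (hB : IsSelfAdjoint B) {z : ℂ}
    (hz : z.im ≠ 0) : z ∉ spectrum ℂ B :=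
  fun h => hz (hB.im_eq_zero_of_mem_spectrum h)

lemma IsSelfAdjoint.isUnit_sub_smul_one {E : Type*} [NormedAddCommGroup E]
    [InnerProductSpace ℂ E] [CompleteSpace E] {B : E →L[ℂ] E} (hB : IsSelfAdjoint B) {z : ℂ}
    (hz : z.im ≠ 0) : IsUnit (B - z • 1) := by
  have h := (spectrum.notMem_iff.1 (hB.notMem_spectrum_of_im_ne_zero hz)).neg
  rwa [neg_sub, Algebra.algebraMap_eq_smul_one] at h

lemma apply_inverse_of_isUnit {E : Type*} [NormedAddCommGroup E] [NormedSpace ℂ E]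
    {B : E →L[ℂ] E} (hB : IsUnit B) (v : E) : B (Ring.inverse B v) = v := by
  exact DFunLike.congr_fun (Ring.mul_inverse_cancel _ hB) v

lemma inverse_apply_eq_of_isUnit {E : Type*} [NormedAddCommGroup E] [NormedSpace ℂ E]
    {B : E →L[ℂ] E} (hB : IsUnit B) {v w : E} (h : B w = v) : Ring.inverse B v = w := by
  exact h ▸ DFunLike.congr_fun (Ring.inverse_mul_cancel _ hB) w

/-- Diagonal resolvent elements of a self-adjoint operator have the Herglotz property. -/
lemma im_inner_inverse_sub_smul {E : Type*} [NormedAddCommGroup E] [InnerProductSpace ℂ E]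
    [CompleteSpace E] {B : E →L[ℂ] E} (hB : IsSelfAdjoint B) {z : ℂ} (hz : z.im ≠ 0) (v : E) :
    (⟪v, Ring.inverse (B - z • 1) v⟫_ℂ).im = z.im * ‖Ring.inverse (B - z • 1) v‖ ^ 2 := by
  set w := Ring.inverse (B - z • 1) v
  have hw : B w - z • w = v := by
    simpa using apply_inverse_of_isUnit (hB.isUnit_sub_smul_one hz) v
  have hre : (⟪B w, w⟫_ℂ).im = 0 := by
    rw [← Complex.conj_eq_iff_im, inner_conj_symm]
    exact (hB.isSymmetric w w).symm
  rw [← hw, inner_sub_left, inner_smul_left, inner_self_eq_norm_sq_to_K, Complex.sub_im, hre]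
  norm_cast
  simp [-Complex.ofReal_pow]

/-- The action of a decorated operator in coordinates. -/
lemma decorated_apply {Γ G : Type*} [DecidableEq Γ] [Fintype G] [DecidableEq G] {O : G}
    {Ho : lp (fun _ : Γ => ℂ) 2 →L[ℂ] lp (fun _ : Γ => ℂ) 2}
    {A : EuclideanSpace ℂ G →L[ℂ] EuclideanSpace ℂ G}
    {H : lp (fun _ : Γ × G => ℂ) 2 →L[ℂ] lp (fun _ : Γ × G => ℂ) 2}
    (hmat : ∀ (x y : Γ) (u v : G),
      ⟪lp.single 2 (x, u) (1 : ℂ), H (lp.single 2 (y, v) 1)⟫_ℂ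
        = (if u = O then (1 : ℂ) else 0) * (if v = O then (1 : ℂ) else 0) *
            ⟪lp.single 2 x (1 : ℂ), Ho (lp.single 2 y 1)⟫_ℂ
          + (if x = y then (1 : ℂ) else 0) *
            ⟪EuclideanSpace.single u (1 : ℂ), A (EuclideanSpace.single v 1)⟫_ℂ)
    (ψ : lp (fun _ : Γ × G => ℂ) 2) (y : Γ) (u : G) :
    H ψ (y, u) = (if u = O then (1 : ℂ) else 0) *
        Ho (lpCompCLM (fun x => (x, O)) (Prod.mk_left_injective O) ψ) y
      + A (WithLp.toLp 2 fun v => ψ (y, v)) u := by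
  let slice := lpCompCLM (fun x : Γ => (x, O)) (Prod.mk_left_injective O)
  let ev (i : Γ × G) := lp.evalCLM ℂ (fun _ : Γ × G => ℂ) 2 i
  have key : (ev (y, u)).comp H =
      (if u = O then (1 : ℂ) else 0) • (lp.evalCLM ℂ (fun _ : Γ => ℂ) 2 y).comp (Ho.comp slice)
      + ∑ v, A (EuclideanSpace.single v 1) u • ev (y, v) := by
    refine lp_clm_ext fun ⟨x, w⟩ => ?_
    have hslice : slice (lp.single 2 (x, w) 1) =
        (if w = O then (1 : ℂ) else 0) • lp.single 2 x 1 := by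
      ext t
      by_cases hw : w = O <;> simp [slice, lp.single_apply, Pi.single_apply, hw, eq_comm]
    have hm := hmat y x u w
    simp only [lp_inner_single_one, EuclideanSpace.inner_single_left] at hm
    have hev (i : Γ × G) (f : lp (fun _ : Γ × G => ℂ) 2) : ev i f = f i := rfl
    have hev' (f : lp (fun _ : Γ => ℂ) 2) : lp.evalCLM ℂ (fun _ : Γ => ℂ) 2 y f = f y := rfl
    simp only [ContinuousLinearMap.comp_apply, add_apply,
      smul_apply, sum_apply, hev, hev', hslice, map_smul,
      hm, lp.single_apply, Pi.single_apply, Prod.mk.injEq]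
    by_cases hxy : y = x <;> by_cases hw : w = O <;> simp [hxy, hw]
  have h := DFunLike.congr_fun key ψ
  have hA : (WithLp.toLp 2 fun v => ψ (y, v)) =
      ∑ v, ψ (y, v) • EuclideanSpace.single v (1 : ℂ) := by
    ext v
    simp [Pi.single_apply]
  rw [hA]
  simp only [ContinuousLinearMap.comp_apply, add_apply,
    smul_apply, sum_apply] at h
  refine h.trans ?_
  simp only [map_sum, map_smul]
  simp [slice, ev, lp.evalCLM, mul_comm]

/- Context: `Γ` is a nonempty countable set, `G` a nonempty finite set, `O ∈ G`.
`ℓ²(Γ)` is formalized as `lp (fun _ : Γ => ℂ) 2` with standard basis vectors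
`lp.single 2 x 1`, and `ℓ²(G)` as `EuclideanSpace ℂ G` with standard basis vectors
`EuclideanSpace.single u 1`.  `H_o` is a bounded self-adjoint operator on `ℓ²(Γ)`,
`A` a self-adjoint operator on `ℓ²(G)`, and the decorated Hamiltonian `H` is the
bounded self-adjoint operator on `ℓ²(Γ × G)` determined by the matrix elements
`⟪δ_{(x,u)}, H δ_{(y,v)}⟫ = [u = O]·[v = O]·⟪δ_x, H_o δ_y⟫ + [x = y]·⟪δ_u, A δ_v⟫`.
Resolvents `(B - z)⁻¹` are expressed as `Ring.inverse (B - z • 1)`, which agrees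
with the resolvent whenever `z ∉ σ(B)`. -/
/-- For every `x ∈ Γ` and every nonreal `z`, both `z ∉ σ(H)` and
`γ(z) ∉ σ(H_o)` where `γ(z) = −1/m(z)` and `m(z) = ⟪δ_O, (A − z)⁻¹ δ_O⟫`, and
`⟪δ_{(x,O)}, (H − z)⁻¹ δ_{(x,O)}⟫ = ⟪δ_x, (H_o − γ(z))⁻¹ δ_x⟫`. -/
theorem statement2
    {Γ : Type*} [Countable Γ] [Nonempty Γ] [DecidableEq Γ]
    {G : Type*} [Fintype G] [Nonempty G] [DecidableEq G]
    (O : G)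
    (Ho : lp (fun _ : Γ => ℂ) 2 →L[ℂ] lp (fun _ : Γ => ℂ) 2)
    (hHo : IsSelfAdjoint Ho)
    (A : EuclideanSpace ℂ G →L[ℂ] EuclideanSpace ℂ G)
    (hA : IsSelfAdjoint A)
    (H : lp (fun _ : Γ × G => ℂ) 2 →L[ℂ] lp (fun _ : Γ × G => ℂ) 2)
    (hH : IsSelfAdjoint H)
    (hmat : ∀ (x y : Γ) (u v : G),
      ⟪lp.single 2 (x, u) (1 : ℂ), H (lp.single 2 (y, v) 1)⟫_ℂ
        = (if u = O then (1 : ℂ) else 0) * (if v = O then (1 : ℂ) else 0) *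
            ⟪lp.single 2 x (1 : ℂ), Ho (lp.single 2 y 1)⟫_ℂ
          + (if x = y then (1 : ℂ) else 0) *
            ⟪EuclideanSpace.single u (1 : ℂ), A (EuclideanSpace.single v 1)⟫_ℂ)
    (x : Γ) (z : ℂ) (hz : z.im ≠ 0) :
    z ∉ spectrum ℂ H ∧
    -(⟪EuclideanSpace.single O (1 : ℂ),
        (Ring.inverse (A - z • 1)) (EuclideanSpace.single O 1)⟫_ℂ)⁻¹ ∉ spectrum ℂ Ho ∧
    ⟪lp.single 2 (x, O) (1 : ℂ), (Ring.inverse (H - z • 1)) (lp.single 2 (x, O) 1)⟫_ℂ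
      = ⟪lp.single 2 x (1 : ℂ),
          (Ring.inverse (Ho -
            (-(⟪EuclideanSpace.single O (1 : ℂ),
                (Ring.inverse (A - z • 1)) (EuclideanSpace.single O 1)⟫_ℂ)⁻¹) • 1))
            (lp.single 2 x 1)⟫_ℂ := by
  set m := ⟪EuclideanSpace.single O (1 : ℂ),
    (Ring.inverse (A - z • 1)) (EuclideanSpace.single O 1)⟫_ℂ with hm
  have hAu := hA.isUnit_sub_smul_one hz
  have hmim : m.im ≠ 0 := by
    rw [hm, im_inner_inverse_sub_smul hA hz]
    refine mul_ne_zero hz (pow_ne_zero _ (norm_ne_zero_iff.2 fun h => ?_))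
    have := apply_inverse_of_isUnit hAu (EuclideanSpace.single O (1 : ℂ))
    rw [h, map_zero] at this
    simpa using congrArg (fun f => f O) this
  have hm0 : m ≠ 0 := fun h => hmim (by simp [h])
  have hγ : (-m⁻¹).im ≠ 0 := by
    simp [Complex.inv_im, hmim, hm0]
  refine ⟨hH.notMem_spectrum_of_im_ne_zero hz, hHo.notMem_spectrum_of_im_ne_zero hγ, ?_⟩
  set ψ := Ring.inverse (H - z • 1) (lp.single 2 (x, O) 1)
  have hψ : H ψ - z • ψ = lp.single 2 (x, O) 1 := by
    simpa using apply_inverse_of_isUnit (hH.isUnit_sub_smul_one hz) (lp.single 2 (x, O) (1 : ℂ))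
  set f := lpCompCLM (fun x => (x, O)) (Prod.mk_left_injective O) ψ with hf
  have hfib (y : Γ) : f y = ((if y = x then 1 else 0) - Ho f y) * m := by
    have hy : (A - z • 1) (WithLp.toLp 2 fun v => ψ (y, v)) =
        ((if y = x then 1 else 0) - Ho f y) • EuclideanSpace.single O (1 : ℂ) := by
      ext u
      have h := congrArg (fun g : lp (fun _ : Γ × G => ℂ) 2 => g (y, u)) hψ
      simp only [lp.coeFn_sub, lp.coeFn_smul, Pi.sub_apply, Pi.smul_apply,
        decorated_apply hmat, lp.single_apply, Pi.single_apply, ← hf, Prod.mk.injEq] at h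
      by_cases hu : u = O <;> by_cases hxy : y = x <;> simp [hu, hxy] at h ⊢ <;>
        linear_combination h
    have h := inverse_apply_eq_of_isUnit hAu hy
    rw [map_smul] at h
    have h' := congrArg (fun g : EuclideanSpace ℂ G => g O) h
    simp only [PiLp.smul_apply, smul_eq_mul] at h'
    rw [hm, EuclideanSpace.inner_single_left, map_one, one_mul, h']
    rfl
  have hres : (Ho - (-m⁻¹) • 1) f = lp.single 2 x 1 := by
    ext y
    have h := hfib y
    have h' : m⁻¹ * f y = (if y = x then 1 else 0) - Ho f y := by
      rw [h]; field_simp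
    change Ho f y - (-m⁻¹) * f y = _
    rw [lp.single_apply, Pi.single_apply]
    linear_combination h'
  rw [inverse_apply_eq_of_isUnit (hHo.isUnit_sub_smul_one hγ) hres, lp_inner_single_one,
    lp_inner_single_one]
  rfl
end

section
/- For every x, y ∈ Γ, every u ∈ G, and every z ∈ ℂ ∖ ℝ, one has ⟨δ_{(x,O)}, (H − z)⁻¹ δ_{(y,u)}⟩ = ⟨δ_x, (H_o − γ(z))⁻¹ δ_y⟩ · ⟨δ_O, (A − z)⁻¹ δ_u⟩ / m(z). -/
open scoped InnerProductSpace

/- Context: `Γ` is a nonempty countable set, `G` a nonempty finite set, `O ∈ G`.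
`ℓ²(Γ)` is formalized as `lp (fun _ : Γ => ℂ) 2` with standard basis vectors
`lp.single 2 x 1`, and `ℓ²(G)` as `EuclideanSpace ℂ G` with standard basis vectors
`EuclideanSpace.single u 1`.  `H_o` is a bounded self-adjoint operator on `ℓ²(Γ)`,
`A` a self-adjoint operator on `ℓ²(G)`, and the decorated Hamiltonian `H` is the
bounded self-adjoint operator on `ℓ²(Γ × G)` determined by the matrix elements
`⟪δ_{(x,u)}, H δ_{(y,v)}⟫ = [u = O]·[v = O]·⟪δ_x, H_o δ_y⟫ + [x = y]·⟪δ_u, A δ_v⟫`.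
Resolvents `(B - z)⁻¹` are expressed as `Ring.inverse (B - z • 1)`, which agrees
with the resolvent whenever `z ∉ σ(B)`. -/

namespace DecoratedHamiltonian

section Resolvent

variable {E : Type*} [NormedAddCommGroup E] [InnerProductSpace ℂ E] [CompleteSpace E]

theorem isUnit_sub_smul_one {B : E →L[ℂ] E} (hB : IsSelfAdjoint B) {z : ℂ} (hz : z.im ≠ 0) :
    IsUnit (B - z • (1 : E →L[ℂ] E)) := by
  have hmem : z ∉ spectrum ℂ B := fun h => hz (hB.im_eq_zero_of_mem_spectrum h)
  have hunit : IsUnit (algebraMap ℂ (E →L[ℂ] E) z - B) := spectrum.notMem_iff.mp hmem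
  rw [Algebra.algebraMap_eq_smul_one] at hunit
  simpa using hunit.neg

theorem sub_smul_one_apply_inverse {B : E →L[ℂ] E} (hB : IsSelfAdjoint B) {z : ℂ}
    (hz : z.im ≠ 0) (f : E) :
    B (Ring.inverse (B - z • (1 : E →L[ℂ] E)) f) - z • Ring.inverse (B - z • (1 : E →L[ℂ] E)) f
      = f := by
  have h := congrArg (fun T : E →L[ℂ] E => T f)
    (Ring.mul_inverse_cancel _ (isUnit_sub_smul_one hB hz))
  simpa using h

theorem inverse_apply_eq {B : E →L[ℂ] E} (hB : IsSelfAdjoint B) {z : ℂ} (hz : z.im ≠ 0)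
    {f g : E} (h : B g - z • g = f) : Ring.inverse (B - z • (1 : E →L[ℂ] E)) f = g := by
  have h' := congrArg (fun T : E →L[ℂ] E => T g)
    (Ring.inverse_mul_cancel _ (isUnit_sub_smul_one hB hz))
  rw [← h]
  simpa using h'

theorem inner_inverse_conj_left {B : E →L[ℂ] E} (hB : IsSelfAdjoint B) {z : ℂ} (hz : z.im ≠ 0)
    (f g : E) :
    ⟪Ring.inverse (B - (starRingEnd ℂ z) • (1 : E →L[ℂ] E)) f, g⟫_ℂ
      = ⟪f, Ring.inverse (B - z • (1 : E →L[ℂ] E)) g⟫_ℂ := by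
  have hz' : (starRingEnd ℂ z).im ≠ 0 := by simpa using hz
  have hf := sub_smul_one_apply_inverse hB hz' f
  have hg := sub_smul_one_apply_inverse hB hz g
  generalize Ring.inverse (B - (starRingEnd ℂ z) • (1 : E →L[ℂ] E)) f = f' at hf ⊢
  generalize Ring.inverse (B - z • (1 : E →L[ℂ] E)) g = g' at hg ⊢
  have hsymm : ⟪B f', g'⟫_ℂ = ⟪f', B g'⟫_ℂ := hB.isSymmetric f' g'
  rw [← hf, ← hg, inner_sub_left, inner_sub_right, inner_smul_left, inner_smul_right, hsymm,
    Complex.conj_conj]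

theorem inner_inverse_self_im_ne_zero {B : E →L[ℂ] E} (hB : IsSelfAdjoint B) {z : ℂ}
    (hz : z.im ≠ 0) {f : E} (hf : f ≠ 0) :
    (⟪f, Ring.inverse (B - z • (1 : E →L[ℂ] E)) f⟫_ℂ).im ≠ 0 := by
  have hg := sub_smul_one_apply_inverse hB hz f
  generalize Ring.inverse (B - z • (1 : E →L[ℂ] E)) f = g at hg ⊢
  have hg0 : g ≠ 0 := by
    rintro rfl
    exact hf (by simpa using hg.symm)
  have hreal : (⟪B g, g⟫_ℂ).im = 0 := hB.isSymmetric.im_inner_apply_self g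
  have hnorm : ⟪g, g⟫_ℂ = ((‖g‖ ^ 2 : ℝ) : ℂ) := by
    rw [inner_self_eq_norm_sq_to_K]
    norm_cast
  rw [← hg, inner_sub_left, inner_smul_left, hnorm, Complex.sub_im, hreal, Complex.im_mul_ofReal,
    Complex.conj_im]
  simpa [hz] using hg0

end Resolvent

section Fiber

variable {Γ G : Type*} [DecidableEq Γ] [DecidableEq G]

theorem inner_single_one_left {ι : Type*} [DecidableEq ι] (i : ι) (f : lp (fun _ : ι => ℂ) 2) :
    ⟪lp.single 2 i (1 : ℂ), f⟫_ℂ = f i := by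
  rw [lp.inner_single_left]
  simp

theorem orthonormal_single_prod (u : G) :
    Orthonormal ℂ
      (fun x : Γ => (lp.single 2 (x, u) (1 : ℂ) : lp (fun _ : Γ × G => ℂ) 2)) := by
  rw [orthonormal_iff_ite]
  intro x y
  rw [inner_single_one_left, lp.single_apply, Pi.single_apply]
  simp

/-- The isometric embedding of `ℓ²(Γ)` onto the functions in `ℓ²(Γ × G)` supported on
`Γ × {u}`. -/
noncomputable def fiberEmbedding (u : G) :
    lp (fun _ : Γ => ℂ) 2 →L[ℂ] lp (fun _ : Γ × G => ℂ) 2 :=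
  (orthonormal_single_prod (Γ := Γ) u).orthogonalFamily.linearIsometry.toContinuousLinearMap

theorem fiberEmbedding_single (u : G) (x : Γ) :
    fiberEmbedding u (lp.single 2 x (1 : ℂ)) = lp.single 2 (x, u) (1 : ℂ) := by
  simp [fiberEmbedding]

theorem continuousLinearMap_ext_single {ι F : Type*} [DecidableEq ι] [NormedAddCommGroup F]
    [NormedSpace ℂ F] {S T : lp (fun _ : ι => ℂ) 2 →L[ℂ] F}
    (h : ∀ i, S (lp.single 2 i (1 : ℂ)) = T (lp.single 2 i (1 : ℂ))) : S = T := by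
  refine lp.ext_continuousLinearMap (by simp) fun i => ?_
  ext
  simpa using h i

theorem fiberEmbedding_apply (u v : G) (x : Γ) (f : lp (fun _ : Γ => ℂ) 2) :
    fiberEmbedding u f (x, v) = if v = u then f x else 0 := by
  have h : (innerSL ℂ (lp.single 2 (x, v) (1 : ℂ) : lp (fun _ : Γ × G => ℂ) 2)).comp
      (fiberEmbedding u) = (if v = u then (1 : ℂ) else 0) •
        innerSL ℂ (lp.single 2 x (1 : ℂ) : lp (fun _ : Γ => ℂ) 2) := by
    refine continuousLinearMap_ext_single fun y => ?_
    simp only [ContinuousLinearMap.comp_apply, smul_apply, innerSL_apply_apply,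
      fiberEmbedding_single, inner_single_one_left, lp.single_apply, Pi.single_apply,
      Prod.mk.injEq, smul_eq_mul]
    split_ifs <;> simp_all
  have h' := congrArg (fun T => T f) h
  simp only [ContinuousLinearMap.comp_apply, smul_apply, innerSL_apply_apply,
    inner_single_one_left, smul_eq_mul] at h'
  simpa using h'

variable [Fintype G] {O : G} {Ho : lp (fun _ : Γ => ℂ) 2 →L[ℂ] lp (fun _ : Γ => ℂ) 2}
  {A : EuclideanSpace ℂ G →L[ℂ] EuclideanSpace ℂ G}
  {H : lp (fun _ : Γ × G => ℂ) 2 →L[ℂ] lp (fun _ : Γ × G => ℂ) 2}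

theorem apply_fiberEmbedding
    (hmat : ∀ (x y : Γ) (u v : G),
      ⟪lp.single 2 (x, u) (1 : ℂ), H (lp.single 2 (y, v) 1)⟫_ℂ
        = (if u = O then (1 : ℂ) else 0) * (if v = O then (1 : ℂ) else 0) *
            ⟪lp.single 2 x (1 : ℂ), Ho (lp.single 2 y 1)⟫_ℂ
          + (if x = y then (1 : ℂ) else 0) *
            ⟪EuclideanSpace.single u (1 : ℂ), A (EuclideanSpace.single v 1)⟫_ℂ)
    (v : G) (f : lp (fun _ : Γ => ℂ) 2) :
    H (fiberEmbedding v f) = (if v = O then (1 : ℂ) else 0) • fiberEmbedding O (Ho f)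
      + ∑ u, A (EuclideanSpace.single v 1) u • fiberEmbedding u f := by
  have h : H.comp (fiberEmbedding v) =
      (if v = O then (1 : ℂ) else 0) • (fiberEmbedding O).comp Ho
        + ∑ u, A (EuclideanSpace.single v 1) u • fiberEmbedding u := by
    refine continuousLinearMap_ext_single fun y => lp.ext ?_
    ext ⟨x, u⟩
    have hxy := hmat x y u v
    simp only [inner_single_one_left, EuclideanSpace.inner_single_left, map_one, one_mul] at hxy
    simp only [ContinuousLinearMap.comp_apply, add_apply,
      smul_apply, sum_apply, fiberEmbedding_single v,
      hxy, lp.coeFn_add, lp.coeFn_smul, lp.coeFn_sum, Pi.add_apply, Pi.smul_apply,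
      Finset.sum_apply, fiberEmbedding_apply, lp.single_apply, Pi.single_apply, smul_eq_mul]
    split_ifs <;> simp_all
  simpa only [ContinuousLinearMap.comp_apply, add_apply, smul_apply, sum_apply]
    using congrArg (fun T => T f) h

/-- If `(A - w) a = δ_O`, then `(H - w) (g ⊗ a) = (a_O H_o + 1) g ⊗ δ_O`. -/
theorem sub_smul_sum_fiberEmbedding
    (hmat : ∀ (x y : Γ) (u v : G),
      ⟪lp.single 2 (x, u) (1 : ℂ), H (lp.single 2 (y, v) 1)⟫_ℂ
        = (if u = O then (1 : ℂ) else 0) * (if v = O then (1 : ℂ) else 0) *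
            ⟪lp.single 2 x (1 : ℂ), Ho (lp.single 2 y 1)⟫_ℂ
          + (if x = y then (1 : ℂ) else 0) *
            ⟪EuclideanSpace.single u (1 : ℂ), A (EuclideanSpace.single v 1)⟫_ℂ)
    {w : ℂ} {a : EuclideanSpace ℂ G} (ha : A a - w • a = EuclideanSpace.single O 1)
    (g : lp (fun _ : Γ => ℂ) 2) :
    H (∑ v, a v • fiberEmbedding v g) - w • ∑ v, a v • fiberEmbedding v g
      = fiberEmbedding O (a O • Ho g + g) := by
  have hA : ∀ u, ∑ v, a v * A (EuclideanSpace.single v 1) u = A a u := by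
    intro u
    have hsum : a = ∑ v, a v • EuclideanSpace.single v (1 : ℂ) := by
      ext u
      simp [Pi.single_apply]
    conv_rhs => rw [hsum]
    simp [map_sum]
  have hH : H (∑ v, a v • fiberEmbedding v g)
      = a O • fiberEmbedding O (Ho g) + ∑ u, A a u • fiberEmbedding u g := by
    simp only [map_sum, map_smul, apply_fiberEmbedding hmat, smul_add, Finset.sum_add_distrib,
      Finset.smul_sum, smul_smul]
    rw [Finset.sum_comm]
    simp only [← Finset.sum_smul, hA]
    simp
  have hu : ∀ u, A a u - w * a u = if u = O then 1 else 0 := by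
    intro u
    simpa [Pi.single_apply] using congrArg (fun b : EuclideanSpace ℂ G => b u) ha
  rw [hH, add_sub_assoc, Finset.smul_sum, ← Finset.sum_sub_distrib]
  simp only [smul_smul, ← sub_smul, hu]
  simp

end Fiber

end DecoratedHamiltonian

open DecoratedHamiltonian in
/-- For every `x, y ∈ Γ`, every `u ∈ G`, and every nonreal `z`,
`⟪δ_{(x,O)}, (H − z)⁻¹ δ_{(y,u)}⟫
  = ⟪δ_x, (H_o − γ(z))⁻¹ δ_y⟫ · ⟪δ_O, (A − z)⁻¹ δ_u⟫ / m(z)`,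
where `m(z) = ⟪δ_O, (A − z)⁻¹ δ_O⟫` and `γ(z) = −1/m(z)`. -/
theorem statement3
    {Γ : Type*} [Countable Γ] [Nonempty Γ] [DecidableEq Γ]
    {G : Type*} [Fintype G] [Nonempty G] [DecidableEq G]
    (O : G)
    (Ho : lp (fun _ : Γ => ℂ) 2 →L[ℂ] lp (fun _ : Γ => ℂ) 2)
    (hHo : IsSelfAdjoint Ho)
    (A : EuclideanSpace ℂ G →L[ℂ] EuclideanSpace ℂ G)
    (hA : IsSelfAdjoint A)
    (H : lp (fun _ : Γ × G => ℂ) 2 →L[ℂ] lp (fun _ : Γ × G => ℂ) 2)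
    (hH : IsSelfAdjoint H)
    (hmat : ∀ (x y : Γ) (u v : G),
      ⟪lp.single 2 (x, u) (1 : ℂ), H (lp.single 2 (y, v) 1)⟫_ℂ
        = (if u = O then (1 : ℂ) else 0) * (if v = O then (1 : ℂ) else 0) *
            ⟪lp.single 2 x (1 : ℂ), Ho (lp.single 2 y 1)⟫_ℂ
          + (if x = y then (1 : ℂ) else 0) *
            ⟪EuclideanSpace.single u (1 : ℂ), A (EuclideanSpace.single v 1)⟫_ℂ)
    (x y : Γ) (u : G) (z : ℂ) (hz : z.im ≠ 0) :
    ⟪lp.single 2 (x, O) (1 : ℂ), (Ring.inverse (H - z • 1)) (lp.single 2 (y, u) 1)⟫_ℂ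
      = ⟪lp.single 2 x (1 : ℂ),
          (Ring.inverse (Ho -
            (-(⟪EuclideanSpace.single O (1 : ℂ),
                (Ring.inverse (A - z • 1)) (EuclideanSpace.single O 1)⟫_ℂ)⁻¹) • 1))
            (lp.single 2 y 1)⟫_ℂ
        * ⟪EuclideanSpace.single O (1 : ℂ),
            (Ring.inverse (A - z • 1)) (EuclideanSpace.single u 1)⟫_ℂ
        / ⟪EuclideanSpace.single O (1 : ℂ),
            (Ring.inverse (A - z • 1)) (EuclideanSpace.single O 1)⟫_ℂ := by
  set m := ⟪EuclideanSpace.single O (1 : ℂ),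
    (Ring.inverse (A - z • 1)) (EuclideanSpace.single O 1)⟫_ℂ with hm
  have hm_im : m.im ≠ 0 := inner_inverse_self_im_ne_zero hA hz (by simp)
  have hm0 : m ≠ 0 := fun h => hm_im (by simp [h])
  have hγ : (-m⁻¹).im ≠ 0 := by simp [Complex.inv_im, hm_im, hm0]
  have hz' : (starRingEnd ℂ z).im ≠ 0 := by simpa using hz
  have hγ' : (starRingEnd ℂ (-m⁻¹)).im ≠ 0 := by rwa [Complex.conj_im, neg_ne_zero]
  have hAu : ∀ v, ⟪EuclideanSpace.single O (1 : ℂ),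
      (Ring.inverse (A - z • 1)) (EuclideanSpace.single v 1)⟫_ℂ = starRingEnd ℂ
        ((Ring.inverse (A - (starRingEnd ℂ z) • (1 : EuclideanSpace ℂ G →L[ℂ] EuclideanSpace ℂ G))
          (EuclideanSpace.single O 1)) v) := by
    intro v
    rw [← inner_inverse_conj_left hA hz, EuclideanSpace.inner_single_right, one_mul]
  have ha := sub_smul_one_apply_inverse hA hz' (EuclideanSpace.single O 1)
  have hg := sub_smul_one_apply_inverse hHo hγ' (lp.single 2 x 1)
  have hmO := hAu O
  rw [← hm] at hmO
  rw [hAu u, ← inner_inverse_conj_left hHo hγ, ← inner_inverse_conj_left hH hz]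
  generalize Ring.inverse (A - (starRingEnd ℂ z) • (1 : EuclideanSpace ℂ G →L[ℂ] EuclideanSpace ℂ G))
    (EuclideanSpace.single O 1) = a at ha hmO ⊢
  generalize Ring.inverse (Ho - (starRingEnd ℂ (-m⁻¹)) •
    (1 : lp (fun _ : Γ => ℂ) 2 →L[ℂ] lp (fun _ : Γ => ℂ) 2)) (lp.single 2 x 1) = g at hg ⊢
  have haO : a O = starRingEnd ℂ m := by rw [hmO, Complex.conj_conj]
  have haO0 : a O ≠ 0 := by simpa [haO] using hm0
  have hsol := sub_smul_sum_fiberEmbedding hmat ha g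
  have hres : Ring.inverse (H - (starRingEnd ℂ z) •
      (1 : lp (fun _ : Γ × G => ℂ) 2 →L[ℂ] lp (fun _ : Γ × G => ℂ) 2)) (lp.single 2 (x, O) 1)
        = (a O)⁻¹ • ∑ v, a v • fiberEmbedding v g := by
    refine inverse_apply_eq hH hz' ?_
    rw [map_smul, smul_comm, ← smul_sub, hsol, ← map_smul, smul_add, smul_smul,
      inv_mul_cancel₀ haO0, one_smul, ← fiberEmbedding_single, ← hg, map_neg, map_inv₀, ← haO,
      neg_smul, sub_neg_eq_add]
  have hval : (∑ v, a v • fiberEmbedding v g : lp (fun _ : Γ × G => ℂ) 2) (y, u) = a u * g y := by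
    rw [← inner_single_one_left, inner_sum]
    simp [inner_smul_right, inner_single_one_left, fiberEmbedding_apply]
  rw [hres, inner_smul_left, map_inv₀, ← hmO, ← inner_conj_symm, inner_single_one_left, hval,
    ← inner_conj_symm g, inner_single_one_left, map_mul]
  field_simp
end

section
/- For every real E with E ∉ {ε_1, …, ε_n}, if γ(E) = E + c + Σ_{j=1}^n w_j/(ε_j − E) belongs to σ(H_o), then E belongs to σ(H). -/
open scoped InnerProductSpace
open Filter Topology

theorem IsSelfAdjoint.isUnit_of_antilipschitz {F : Type*} [NormedAddCommGroup F]
    [InnerProductSpace ℂ F] [CompleteSpace F] {B : F →L[ℂ] F} (hB : IsSelfAdjoint B)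
    {K : NNReal} (hK : AntilipschitzWith K B) : IsUnit B := by
  rw [ContinuousLinearMap.isUnit_iff_bijective,
    ContinuousLinearMap.bijective_iff_dense_range_and_antilipschitz]
  refine ⟨?_, K, hK⟩
  rw [Submodule.topologicalClosure_eq_top_iff, B.orthogonal_range,
    ContinuousLinearMap.isSelfAdjoint_iff'.1 hB]
  exact LinearMap.ker_eq_bot.2 hK.injective

theorem lp.hasSum_norm_sq {ι : Type*} (f : lp (fun _ : ι => ℂ) 2) :
    HasSum (fun i => ‖f i‖ ^ 2) (‖f‖ ^ 2) := by
  have h := lp.hasSum_norm (p := 2) (by norm_num) f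
  simpa using h

section Tensor

variable {Γ G : Type*} [Fintype G]

theorem hasSum_norm_sq_tensor (g : EuclideanSpace ℂ G) (ψ : lp (fun _ : Γ => ℂ) 2) :
    HasSum (fun p : Γ × G => ‖ψ p.1 * g p.2‖ ^ 2) (‖ψ‖ ^ 2 * ‖g‖ ^ 2) := by
  have hψ := lp.hasSum_norm_sq ψ
  have hg : HasSum (fun u => ‖g u‖ ^ 2) (‖g‖ ^ 2) := by
    rw [EuclideanSpace.norm_sq_eq]
    exact hasSum_fintype _
  have hψg := hψ.summable.mul_of_nonneg hg.summable
    (fun _ => by positivity) (fun _ => by positivity)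
  have h := hψ.mul hg hψg
  simpa only [norm_mul, mul_pow] using h

/-- The function `(x, u) ↦ ψ x * g u` as an element of `ℓ²(Γ × G)`. -/
noncomputable def l2Tensor (g : EuclideanSpace ℂ G) (ψ : lp (fun _ : Γ => ℂ) 2) :
    lp (fun _ : Γ × G => ℂ) 2 :=
  ⟨fun p => ψ p.1 * g p.2, memℓp_gen (by simpa using (hasSum_norm_sq_tensor g ψ).summable)⟩

@[simp]
theorem l2Tensor_apply (g : EuclideanSpace ℂ G) (ψ : lp (fun _ : Γ => ℂ) 2) (p : Γ × G) :
    l2Tensor g ψ p = ψ p.1 * g p.2 := rfl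

theorem norm_l2Tensor (g : EuclideanSpace ℂ G) (ψ : lp (fun _ : Γ => ℂ) 2) :
    ‖l2Tensor g ψ‖ = ‖ψ‖ * ‖g‖ := by
  have h : ‖l2Tensor g ψ‖ ^ 2 = (‖ψ‖ * ‖g‖) ^ 2 := by
    rw [mul_pow]
    exact (lp.hasSum_norm_sq (l2Tensor g ψ)).unique (hasSum_norm_sq_tensor g ψ)
  exact (sq_eq_sq₀ (by positivity) (by positivity)).1 h

/-- Tensoring on the right with a fixed vector, as a bounded operator `ℓ²(Γ) → ℓ²(Γ × G)`. -/
noncomputable def l2TensorCLM (g : EuclideanSpace ℂ G) :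
    lp (fun _ : Γ => ℂ) 2 →L[ℂ] lp (fun _ : Γ × G => ℂ) 2 :=
  LinearMap.mkContinuous
    { toFun := l2Tensor g
      map_add' := fun φ ψ => by ext p; simp [add_mul]
      map_smul' := fun a ψ => by ext p; simp [mul_assoc] }
    ‖g‖ (fun ψ => by simp [norm_l2Tensor, mul_comm])

@[simp]
theorem l2TensorCLM_apply (g : EuclideanSpace ℂ G) (ψ : lp (fun _ : Γ => ℂ) 2) :
    l2TensorCLM g ψ = l2Tensor g ψ := rfl

variable [DecidableEq Γ] [DecidableEq G]

theorem l2Tensor_single (g : EuclideanSpace ℂ G) (y : Γ) :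
    l2Tensor g (lp.single 2 y (1 : ℂ)) = ∑ v, g v • lp.single 2 (y, v) (1 : ℂ) := by
  ext ⟨x, u⟩
  rw [lp.coeFn_sum, Finset.sum_apply]
  by_cases h : x = y
  · subst h
    simp [lp.single_apply, Pi.single_apply]
  · simp [lp.single_apply, h]

theorem lp.apply_eq_inner_single {ι : Type*} [DecidableEq ι] (f : lp (fun _ : ι => ℂ) 2) (i : ι) :
    f i = ⟪lp.single 2 i (1 : ℂ), f⟫_ℂ := by
  simp [lp.inner_single_left]

theorem decorated_apply_l2Tensor (O : G)
    (Ho : lp (fun _ : Γ => ℂ) 2 →L[ℂ] lp (fun _ : Γ => ℂ) 2)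
    (A : EuclideanSpace ℂ G →L[ℂ] EuclideanSpace ℂ G)
    (H : lp (fun _ : Γ × G => ℂ) 2 →L[ℂ] lp (fun _ : Γ × G => ℂ) 2)
    (hmat : ∀ (x y : Γ) (u v : G),
      ⟪lp.single 2 (x, u) (1 : ℂ), H (lp.single 2 (y, v) 1)⟫_ℂ
        = (if u = O then (1 : ℂ) else 0) * (if v = O then (1 : ℂ) else 0) *
            ⟪lp.single 2 x (1 : ℂ), Ho (lp.single 2 y 1)⟫_ℂ
          + (if x = y then (1 : ℂ) else 0) *
            ⟪EuclideanSpace.single u (1 : ℂ), A (EuclideanSpace.single v 1)⟫_ℂ)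
    (g : EuclideanSpace ℂ G) (ψ : lp (fun _ : Γ => ℂ) 2) :
    H (l2Tensor g ψ) =
      g O • l2Tensor (EuclideanSpace.single O 1) (Ho ψ) + l2Tensor (A g) ψ := by
  have hAg : ∀ u, A g u = ∑ v, g v * A (EuclideanSpace.single v 1) u := fun u => by
    conv_lhs => rw [← (EuclideanSpace.basisFun G ℂ).sum_repr g]
    simp
  suffices h : H ∘L l2TensorCLM g =
      g O • (l2TensorCLM (EuclideanSpace.single O 1) ∘L Ho) + l2TensorCLM (A g) from
    DFunLike.congr_fun h ψ
  refine lp.ext_continuousLinearMap (by norm_num) fun y => ?_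
  ext ⟨x, u⟩
  have hsum : (H (l2Tensor g (lp.single 2 y (1 : ℂ)))) (x, u) =
      ∑ v, g v * ⟪lp.single 2 (x, u) (1 : ℂ), H (lp.single 2 (y, v) 1)⟫_ℂ := by
    rw [lp.apply_eq_inner_single, l2Tensor_single, map_sum, inner_sum]
    simp only [map_smul, inner_smul_right]
  have hHo := lp.apply_eq_inner_single (Ho (lp.single 2 y (1 : ℂ))) x
  simp only [hmat, ← hHo, mul_add, Finset.sum_add_distrib] at hsum
  have hA' : ∀ v, ⟪EuclideanSpace.single u (1 : ℂ), A (EuclideanSpace.single v 1)⟫_ℂ =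
      A (EuclideanSpace.single v 1) u := fun v => by simp [EuclideanSpace.inner_single_left]
  change (H (l2Tensor g (lp.single 2 y (1 : ℂ)))) (x, u) =
    g O * l2Tensor (EuclideanSpace.single O 1) (Ho (lp.single 2 y (1 : ℂ))) (x, u) +
      l2Tensor (A g) (lp.single 2 y (1 : ℂ)) (x, u)
  rw [hsum, l2Tensor_apply, l2Tensor_apply, hAg]
  simp only [hA', lp.single_apply]
  by_cases hu : u = O <;> by_cases hx : x = y <;> simp [hu, hx]

end Tensor

section ResolventVector

variable {G : Type*} [Fintype G] [DecidableEq G]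

theorem exists_apply_eq_one_of_neg_inv_resolvent_eq {A : EuclideanSpace ℂ G →L[ℂ] EuclideanSpace ℂ G}
    (hA : IsSelfAdjoint A) (O : G) {z γ : ℂ} (hz : z.im ≠ 0) (hγ : γ ≠ 0)
    (h : -(⟪EuclideanSpace.single O (1 : ℂ),
          (Ring.inverse (A - z • 1)) (EuclideanSpace.single O 1)⟫_ℂ)⁻¹ = γ) :
    ∃ g : EuclideanSpace ℂ G, g O = 1 ∧ A g - z • g = -γ • EuclideanSpace.single O (1 : ℂ) := by
  have hu : IsUnit (A - z • (1 : EuclideanSpace ℂ G →L[ℂ] EuclideanSpace ℂ G)) := by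
    by_contra hn
    refine hz (hA.im_eq_zero_of_mem_spectrum (z := z) ?_)
    rw [spectrum.mem_iff, Algebra.algebraMap_eq_smul_one, ← IsUnit.neg_iff, neg_sub]
    exact hn
  set r := (Ring.inverse (A - z • 1)) (EuclideanSpace.single O (1 : ℂ)) with hr
  have hr' : A r - z • r = EuclideanSpace.single O 1 := by
    have := DFunLike.congr_fun (Ring.mul_inverse_cancel _ hu) (EuclideanSpace.single O (1 : ℂ))
    simpa [← hr] using this
  have hrO : ⟪EuclideanSpace.single O (1 : ℂ), r⟫_ℂ = r O := by
    simp [EuclideanSpace.inner_single_left]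
  rw [hrO] at h
  have hr0 : r O ≠ 0 := by
    intro h0
    rw [h0] at h
    simp at h
    exact hγ h.symm
  refine ⟨-γ • r, ?_, ?_⟩
  · rw [← h]
    simp [hr0]
  · rw [map_smul, smul_comm z, ← smul_sub, hr']

theorem im_mul_norm_sq_eq {A : EuclideanSpace ℂ G →L[ℂ] EuclideanSpace ℂ G}
    (hA : IsSelfAdjoint A) {O : G} {z γ : ℂ} {g : EuclideanSpace ℂ G} (hO : g O = 1)
    (h : A g - z • g = -γ • EuclideanSpace.single O (1 : ℂ)) :
    z.im * ‖g‖ ^ 2 = γ.im := by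
  have h1 := congrArg (fun v => (⟪g, v⟫_ℂ).im) h
  have h2 : (⟪g, A g⟫_ℂ).im = 0 := by
    have := hA.isSymmetric.im_inner_self_apply g
    simpa using this
  have h3 : ⟪g, g⟫_ℂ = ((‖g‖ ^ 2 : ℝ) : ℂ) := by
    simp [inner_self_eq_norm_sq_to_K]
  simp only [inner_sub_right, inner_smul_right, h3, EuclideanSpace.inner_single_right, hO,
    Complex.sub_im, Complex.im_mul_ofReal, h2] at h1
  simpa using h1

theorem exists_apply_eq_one_of_tendsto (A : EuclideanSpace ℂ G →L[ℂ] EuclideanSpace ℂ G)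
    (O : G) {z γ : ℕ → ℂ} {E γ₀ : ℂ} (hz : Tendsto z atTop (𝓝 E)) (hγ : Tendsto γ atTop (𝓝 γ₀))
    {g : ℕ → EuclideanSpace ℂ G} {C : ℝ} (hC : ∀ k, ‖g k‖ ≤ C) (hO : ∀ k, g k O = 1)
    (h : ∀ k, A (g k) - z k • g k = -γ k • EuclideanSpace.single O (1 : ℂ)) :
    ∃ g₀ : EuclideanSpace ℂ G, g₀ O = 1 ∧
      A g₀ - E • g₀ = -γ₀ • EuclideanSpace.single O (1 : ℂ) := by
  obtain ⟨g₀, -, φ, hφ, hlim⟩ := tendsto_subseq_of_bounded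
    (Metric.isBounded_closedBall (x := (0 : EuclideanSpace ℂ G)) (r := C))
    (fun k => mem_closedBall_zero_iff.2 (hC k))
  have hφ' := hφ.tendsto_atTop
  refine ⟨g₀, ?_, ?_⟩
  · refine tendsto_nhds_unique
      (((EuclideanSpace.proj O : EuclideanSpace ℂ G →L[ℂ] ℂ).continuous.tendsto g₀).comp hlim) (tendsto_const_nhds.congr fun k => ?_)
    simp [hO]
  · refine tendsto_nhds_unique (((A.continuous.tendsto g₀).comp hlim).sub
      ((hz.comp hφ').smul hlim)) (((hγ.comp hφ').neg.smul_const _).congr fun k => ?_)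
    exact (h _).symm

theorem im_herglotz {n : ℕ} (c : ℝ) (ε w : Fin n → ℝ) (z : ℂ) :
    (z + (c : ℂ) + ∑ j, (w j : ℂ) / ((ε j : ℂ) - z)).im
      = z.im * (1 + ∑ j, w j / Complex.normSq (ε j - z)) := by
  have h : ∀ j, ((w j : ℂ) / ((ε j : ℂ) - z)).im = z.im * (w j / Complex.normSq (ε j - z)) := by
    intro j
    simp [Complex.div_im]
    ring
  rw [Complex.add_im, Complex.im_sum, Finset.sum_congr rfl fun j _ => h j, ← Finset.mul_sum]
  simp
  ring

theorem exists_apply_eq_one_of_herglotz {A : EuclideanSpace ℂ G →L[ℂ] EuclideanSpace ℂ G}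
    (hA : IsSelfAdjoint A) (O : G)
    (c : ℝ) (n : ℕ) (ε : Fin n → ℝ) (w : Fin n → ℝ) (hw : ∀ j, 0 < w j)
    (hpf : ∀ z : ℂ, z.im ≠ 0 →
      -(⟪EuclideanSpace.single O (1 : ℂ),
          (Ring.inverse (A - z • 1)) (EuclideanSpace.single O 1)⟫_ℂ)⁻¹
        = z + (c : ℂ) + ∑ j, (w j : ℂ) / ((ε j : ℂ) - z))
    (E : ℝ) (hE : ∀ j, E ≠ ε j) :
    ∃ g : EuclideanSpace ℂ G, g O = 1 ∧ A g - (E : ℂ) • g =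
      -((E + c + ∑ j, w j / (ε j - E) : ℝ) : ℂ) • EuclideanSpace.single O (1 : ℂ) := by
  set γ : ℂ → ℂ := fun z => z + (c : ℂ) + ∑ j, (w j : ℂ) / ((ε j : ℂ) - z) with hγ
  have hden : ∀ j, (ε j : ℂ) - (E : ℂ) ≠ 0 := fun j => by
    rw [← Complex.ofReal_sub, Complex.ofReal_ne_zero]
    exact sub_ne_zero.2 (hE j).symm
  have hγE : ((E + c + ∑ j, w j / (ε j - E) : ℝ) : ℂ) = γ E := by simp [hγ]
  have hcont : ContinuousAt γ E := by
    refine (continuousAt_id.add continuousAt_const).add ?_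
    refine tendsto_finsetSum _ fun j _ => ?_
    exact (continuousAt_const.div (continuousAt_const.sub continuousAt_id) (hden j)).tendsto
  set z : ℕ → ℂ := fun k => (E : ℂ) + ((1 / ((k : ℝ) + 1) : ℝ) : ℂ) * Complex.I with hz
  have hzim : ∀ k, (z k).im = 1 / ((k : ℝ) + 1) := fun k => by
    simp only [hz, Complex.add_im, Complex.ofReal_im, Complex.im_ofReal_mul, Complex.I_im]
    ring
  have hzpos : ∀ k, 0 < (z k).im := fun k => by rw [hzim]; positivity
  have hzlim : Tendsto z atTop (𝓝 E) := by
    have h := (Complex.continuous_ofReal.tendsto 0).comp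
      (tendsto_one_div_add_atTop_nhds_zero_nat (𝕜 := ℝ))
    simpa [hz] using (h.mul_const Complex.I).const_add (E : ℂ)
  have hs : ∀ z : ℂ, 0 ≤ ∑ j, w j / Complex.normSq (ε j - z) := fun z =>
    Finset.sum_nonneg fun j _ => div_nonneg (hw j).le (Complex.normSq_nonneg _)
  have hγ0 : ∀ k, γ (z k) ≠ 0 := fun k h0 => by
    have h := im_herglotz c ε w (z k)
    rw [show z k + (c : ℂ) + ∑ j, (w j : ℂ) / ((ε j : ℂ) - z k) = 0 from h0, Complex.zero_im] at h
    have := mul_pos (hzpos k) (add_pos_of_pos_of_nonneg one_pos (hs (z k)))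
    exact this.ne h
  choose g hgO hg using fun k =>
    exists_apply_eq_one_of_neg_inv_resolvent_eq hA O (hzpos k).ne' (hγ0 k) (hpf (z k) (hzpos k).ne')
  have hnorm : ∀ k, ‖g k‖ ^ 2 = 1 + ∑ j, w j / Complex.normSq (ε j - z k) := fun k =>
    mul_left_cancel₀ (hzpos k).ne' <|
      (im_mul_norm_sq_eq hA (hgO k) (hg k)).trans (im_herglotz c ε w (z k))
  have hbound : ∀ k, ‖g k‖ ^ 2 ≤ 1 + ∑ j, w j / (ε j - E) ^ 2 := fun k => by
    rw [hnorm]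
    gcongr with j
    · exact (hw j).le
    · exact sq_pos_of_ne_zero (sub_ne_zero.2 (hE j).symm)
    · have hre : (z k).re = E := by simp [hz]
      rw [Complex.normSq_apply]
      simp only [Complex.sub_re, Complex.ofReal_re, hre]
      nlinarith [mul_self_nonneg ((ε j : ℂ) - z k).im]
  rw [hγE]
  exact exists_apply_eq_one_of_tendsto A O hzlim (hcont.tendsto.comp hzlim)
    (fun k => Real.le_sqrt_of_sq_le (hbound k)) hgO hg

end ResolventVector

/- Context: `Γ` is a nonempty countable set, `G` a nonempty finite set, `O ∈ G`.
`ℓ²(Γ)` is formalized as `lp (fun _ : Γ => ℂ) 2` with standard basis vectors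
`lp.single 2 x 1`, and `ℓ²(G)` as `EuclideanSpace ℂ G` with standard basis vectors
`EuclideanSpace.single u 1`.  `H_o` is a bounded self-adjoint operator on `ℓ²(Γ)`,
`A` a self-adjoint operator on `ℓ²(G)`, and the decorated Hamiltonian `H` is the
bounded self-adjoint operator on `ℓ²(Γ × G)` determined by the matrix elements
`⟪δ_{(x,u)}, H δ_{(y,v)}⟫ = [u = O]·[v = O]·⟪δ_x, H_o δ_y⟫ + [x = y]·⟪δ_u, A δ_v⟫`.
Resolvents `(B - z)⁻¹` are expressed as `Ring.inverse (B - z • 1)`, which agrees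
with the resolvent whenever `z ∉ σ(B)`. -/
/-- Suppose `c ∈ ℝ`, `n ∈ ℕ`, pairwise distinct reals `ε_1, …, ε_n`
and strictly positive reals `w_1, …, w_n` satisfy
`−1/m(z) = z + c + Σ_j w_j/(ε_j − z)` for all nonreal `z`, where
`m(z) = ⟪δ_O, (A − z)⁻¹ δ_O⟫`.  Then for every real `E ∉ {ε_1, …, ε_n}`, if
`γ(E) = E + c + Σ_j w_j/(ε_j − E)` belongs to `σ(H_o)`, then `E` belongs to `σ(H)`. -/
theorem statement4
    {Γ : Type*} [Countable Γ] [Nonempty Γ] [DecidableEq Γ]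
    {G : Type*} [Fintype G] [Nonempty G] [DecidableEq G]
    (O : G)
    (Ho : lp (fun _ : Γ => ℂ) 2 →L[ℂ] lp (fun _ : Γ => ℂ) 2)
    (hHo : IsSelfAdjoint Ho)
    (A : EuclideanSpace ℂ G →L[ℂ] EuclideanSpace ℂ G)
    (hA : IsSelfAdjoint A)
    (H : lp (fun _ : Γ × G => ℂ) 2 →L[ℂ] lp (fun _ : Γ × G => ℂ) 2)
    (hH : IsSelfAdjoint H)
    (hmat : ∀ (x y : Γ) (u v : G),
      ⟪lp.single 2 (x, u) (1 : ℂ), H (lp.single 2 (y, v) 1)⟫_ℂ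
        = (if u = O then (1 : ℂ) else 0) * (if v = O then (1 : ℂ) else 0) *
            ⟪lp.single 2 x (1 : ℂ), Ho (lp.single 2 y 1)⟫_ℂ
          + (if x = y then (1 : ℂ) else 0) *
            ⟪EuclideanSpace.single u (1 : ℂ), A (EuclideanSpace.single v 1)⟫_ℂ)
    (c : ℝ) (n : ℕ) (ε : Fin n → ℝ) (w : Fin n → ℝ)
    (hε : Function.Injective ε) (hw : ∀ j, 0 < w j)
    (hpf : ∀ z : ℂ, z.im ≠ 0 →
      -(⟪EuclideanSpace.single O (1 : ℂ),
          (Ring.inverse (A - z • 1)) (EuclideanSpace.single O 1)⟫_ℂ)⁻¹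
        = z + (c : ℂ) + ∑ j, (w j : ℂ) / ((ε j : ℂ) - z))
    (E : ℝ) (hE : ∀ j, E ≠ ε j)
    (hspec : ((E + c + ∑ j, w j / (ε j - E) : ℝ) : ℂ) ∈ spectrum ℂ Ho) :
    (E : ℂ) ∈ spectrum ℂ H := by
  obtain ⟨g, hgO, hg⟩ := exists_apply_eq_one_of_herglotz hA O c n ε w hw hpf E hE
  set γ : ℝ := E + c + ∑ j, w j / (ε j - E)
  contrapose hspec
  rw [spectrum.notMem_iff, Algebra.algebraMap_eq_smul_one, ← IsUnit.neg_iff, neg_sub] at hspec ⊢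
  have hkey : ∀ ψ : lp (fun _ : Γ => ℂ) 2,
      (H - (E : ℂ) • 1) (l2Tensor g ψ) =
        l2Tensor (EuclideanSpace.single O 1) ((Ho - (γ : ℂ) • 1) ψ) := fun ψ => by
    have hAg : A g = (E : ℂ) • g - (γ : ℂ) • EuclideanSpace.single O (1 : ℂ) := by
      rw [sub_eq_iff_eq_add'.1 hg, neg_smul, sub_eq_add_neg]
    have h := decorated_apply_l2Tensor O Ho A H hmat g ψ
    rw [hgO, one_smul] at h
    change H (l2Tensor g ψ) - (E : ℂ) • l2Tensor g ψ = _
    rw [h, hAg]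
    ext ⟨x, u⟩
    let δ : EuclideanSpace ℂ G := EuclideanSpace.single O 1
    change (Ho ψ x * δ u + ψ x * ((E : ℂ) * g u - (γ : ℂ) * δ u)) - (E : ℂ) * (ψ x * g u) =
      (Ho ψ x - (γ : ℂ) * ψ x) * δ u
    ring
  obtain ⟨K, hK⟩ := (ContinuousLinearMap.bijective_iff_dense_range_and_antilipschitz _).1
    (ContinuousLinearMap.isUnit_iff_bijective.1 hspec) |>.2
  have hg1 : 1 ≤ ‖g‖ := by simpa [hgO] using PiLp.norm_apply_le g O
  have hself : IsSelfAdjoint (Ho - (γ : ℂ) • (1 : lp (fun _ : Γ => ℂ) 2 →L[ℂ] _)) :=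
    hHo.sub (IsSelfAdjoint.smul (Complex.conj_ofReal γ) (IsSelfAdjoint.one _))
  refine hself.isUnit_of_antilipschitz (K := K) ?_
  refine ContinuousLinearMap.antilipschitz_of_bound _ fun ψ => ?_
  have h := hK.le_mul_norm (map_zero _) (l2Tensor g ψ)
  rw [hkey, norm_l2Tensor, norm_l2Tensor, PiLp.norm_single, norm_one, mul_one] at h
  exact (le_mul_of_one_le_right (norm_nonneg ψ) hg1).trans h
end

section
/- Assume in addition that δ_O is a cyclic vector for A, i.e., the linear span of {A^k δ_O : k ∈ ℕ} is all of ℓ²(G). Then σ(H) = { E ∈ ℝ : E ∉ {ε_1, …, ε_n} and γ(E) ∈ σ(H_o) }. -/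
open scoped InnerProductSpace

open Polynomial in
/-- A scalar matrix perturbed in a single diagonal entry by a ring element `T` is invertible iff
its formal determinant is; no commutativity of the ambient ring is needed. -/
lemma isUnit_map_add_single_iff {G R : Type*} [Fintype G] [DecidableEq G] [Ring R] [Algebra ℂ R]
    (a : Matrix G G ℂ) (O : G) (T : R) (h : a.adjugate O O = 0 → a.det ≠ 0) :
    IsUnit (a.map (algebraMap ℂ R) + Matrix.single O O T) ↔
      IsUnit (algebraMap ℂ R a.det + a.adjugate O O • T) := by
  set N : Matrix G G ℂ[X] := a.map C + Matrix.single O O X with hN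
  have hrow : ((a.map C).updateRow O (Pi.single O 1)).det = C (a.adjugate O O) := by
    rw [← Matrix.adjugate_apply]
    have := RingHom.map_adjugate (C : ℂ →+* ℂ[X]) a
    simpa using (congrFun (congrFun this O) O).symm
  have hNrow : N = (a.map C).updateRow O ((a.map C) O + (X : ℂ[X]) • Pi.single O 1) := by
    ext1 i j
    by_cases hi : i = O
    · subst hi
      by_cases hj : j = i
      · subst hj; simp [hN]
      · simp [hN, Ne.symm hj, hj]
    · simp [hN, hi, Ne.symm hi]
  have hdet : N.det = C a.det + X * C (a.adjugate O O) := by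
    rw [hNrow, Matrix.det_updateRow_add, Matrix.det_updateRow_smul, Matrix.updateRow_eq_self, hrow,
      RingHom.map_det]
    rfl
  have hadj : N.adjugate O O = C (a.adjugate O O) := by
    rw [Matrix.adjugate_apply, hNrow, Matrix.updateRow_idem, hrow]
  set f : ℂ[X] →+* R := (aeval T : ℂ[X] →ₐ[ℂ] R).toRingHom with hf
  have hfd : f N.det = algebraMap ℂ R a.det + a.adjugate O O • T := by
    simp [hf, hdet, Algebra.smul_def, Algebra.commutes]
  have hfN : N.map f = a.map (algebraMap ℂ R) + Matrix.single O O T := by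
    ext1 i j
    simp only [hN, hf, Matrix.single_apply, Matrix.map_apply, Matrix.add_apply]
    split_ifs <;> simp
  have hfa : (N.adjugate.map f) O O = algebraMap ℂ R (a.adjugate O O) := by
    simp [hf, hadj]
  have h1 : (N.map f) * (N.adjugate.map f) = Matrix.scalar G (f N.det) := by
    rw [← Matrix.map_mul, Matrix.mul_adjugate]
    ext1 i j
    by_cases hij : i = j <;> simp [hij]
  have h2 : (N.adjugate.map f) * (N.map f) = Matrix.scalar G (f N.det) := by
    rw [← Matrix.map_mul, Matrix.adjugate_mul]
    ext1 i j
    by_cases hij : i = j <;> simp [hij]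
  rw [← hfN, ← hfd]
  constructor
  · intro hu
    by_cases hQ : a.adjugate O O = 0
    · rw [hfd, hQ, zero_smul, add_zero]
      exact (IsUnit.mk0 _ (h hQ)).map (algebraMap ℂ R)
    · obtain ⟨U, hU⟩ := hu
      rw [← hU] at h1 h2
      have e1 : N.adjugate.map f = (↑U⁻¹ : Matrix G G R) * Matrix.scalar G (f N.det) := by
        rw [← h1, ← mul_assoc, Units.inv_mul, one_mul]
      have e2 : N.adjugate.map f = Matrix.scalar G (f N.det) * (↑U⁻¹ : Matrix G G R) := by
        rw [← h2, mul_assoc, Units.mul_inv, mul_one]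
      have e1' := congrFun (congrFun e1 O) O
      have e2' := congrFun (congrFun e2 O) O
      rw [hfa] at e1' e2'
      simp only [Matrix.scalar_apply, Matrix.mul_diagonal, Matrix.diagonal_mul] at e1' e2'
      obtain ⟨q, hq⟩ := (IsUnit.mk0 _ hQ).map (algebraMap ℂ R)
      rw [← hq] at e1' e2'
      refine isUnit_iff_exists_and_exists.2 ⟨⟨(↑U⁻¹ : Matrix G G R) O O * ↑q⁻¹, ?_⟩,
        ⟨↑q⁻¹ * (↑U⁻¹ : Matrix G G R) O O, ?_⟩⟩
      · rw [← mul_assoc, ← e2', Units.mul_inv]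
      · rw [mul_assoc, ← e1', Units.inv_mul]
  · intro hu
    have hs := hu.map (Matrix.scalar G)
    obtain ⟨s, hs⟩ := hs
    rw [← hs] at h1 h2
    refine isUnit_iff_exists_and_exists.2 ⟨⟨N.adjugate.map f * (↑s⁻¹ : Matrix G G R), ?_⟩,
      ⟨(↑s⁻¹ : Matrix G G R) * N.adjugate.map f, ?_⟩⟩
    · rw [← mul_assoc, h1, Units.mul_inv]
    · rw [mul_assoc, h2, Units.inv_mul]

/-- Operators on a finite direct sum, given by inclusions `J` and projections `π`, as block
matrices. -/
noncomputable def blockMulEquiv {G K L : Type*} [Fintype G] [DecidableEq G]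
    [NormedAddCommGroup K] [NormedSpace ℂ K] [NormedAddCommGroup L] [NormedSpace ℂ L]
    (J : G → K →L[ℂ] L) (π : G → L →L[ℂ] K)
    (hπJ : ∀ u v, π u ∘L J v = if u = v then 1 else 0) (hJπ : ∑ u, J u ∘L π u = 1) :
    (L →L[ℂ] L) ≃* Matrix G G (K →L[ℂ] K) where
  toFun X := Matrix.of fun u v => π u ∘L X ∘L J v
  invFun M := ∑ u, ∑ v, J u ∘L M u v ∘L π v
  left_inv X := by
    have h (f : L) : ∑ u, J u (π u f) = f := by
      simpa using DFunLike.congr_fun hJπ f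
    ext1 f
    simp [← map_sum, h]
  right_inv M := by
    have h (u v : G) (f : K) : π u (J v f) = if u = v then f else 0 := by
      have := DFunLike.congr_fun (hπJ u v) f
      split_ifs at this ⊢ <;> simpa using this
    ext u v f
    simp [h, apply_ite]
  map_mul' X Y := by
    have h (f : L) : ∑ u, J u (π u f) = f := by
      simpa using DFunLike.congr_fun hJπ f
    ext u v f
    simp [Matrix.mul_apply, ← map_sum, h]

/-- Pullback along an injective map of index types, as a bounded operator on `ℓ²`. -/
noncomputable def lpRestrict {α β : Type*} (g : α → β) (hg : Function.Injective g) :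
    lp (fun _ : β => ℂ) 2 →L[ℂ] lp (fun _ : α => ℂ) 2 :=
  LinearMap.mkContinuous
    { toFun := fun f => ⟨fun x => f (g x), memℓp_gen
        (((memℓp_gen_iff (by simp)).1 (lp.memℓp f)).comp_injective hg)⟩
      map_add' := fun _ _ => rfl
      map_smul' := fun _ _ => rfl } 1 fun f => by
    rw [one_mul, ← Real.rpow_le_rpow_iff (norm_nonneg _) (norm_nonneg _) (z := (2 : ENNReal).toReal)
      (by simp), lp.norm_rpow_eq_tsum (by simp), lp.norm_rpow_eq_tsum (by simp)]
    have hs := (memℓp_gen_iff (by simp)).1 (lp.memℓp f)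
    exact (hs.comp_injective hg).tsum_le_tsum_of_inj g hg (fun _ _ => by positivity)
      (fun _ => le_rfl) hs

@[simp]
lemma lpRestrict_apply {α β : Type*} (g : α → β) (hg : Function.Injective g)
    (f : lp (fun _ : β => ℂ) 2) (x : α) : lpRestrict g hg f x = f (g x) := rfl

lemma lp_apply_eq_inner_single {α : Type*} [DecidableEq α] (f : lp (fun _ : α => ℂ) 2) (x : α) :
    f x = ⟪lp.single 2 x (1 : ℂ), f⟫_ℂ := by
  simp [lp.inner_single_left]

lemma adjoint_lpRestrict_apply_of_eq {α β : Type*} [DecidableEq α] [DecidableEq β] (g : α → β)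
    (hg : Function.Injective g) (f : lp (fun _ : α => ℂ) 2) (x : α) :
    (lpRestrict g hg).adjoint f (g x) = f x := by
  have : lpRestrict g hg (lp.single 2 (g x) 1) = lp.single 2 x 1 := by
    ext y
    simp [Pi.single_apply, hg.eq_iff]
  rw [lp_apply_eq_inner_single, ContinuousLinearMap.adjoint_inner_right, this,
    ← lp_apply_eq_inner_single]

lemma adjoint_lpRestrict_apply_of_notMem {α β : Type*} [DecidableEq α] [DecidableEq β] (g : α → β)
    (hg : Function.Injective g) (f : lp (fun _ : α => ℂ) 2) (y : β) (hy : y ∉ Set.range g) :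
    (lpRestrict g hg).adjoint f y = 0 := by
  have : lpRestrict g hg (lp.single 2 y 1) = 0 := by
    ext x
    have : g x ≠ y := fun h => hy ⟨x, h⟩
    simp [this]
  rw [lp_apply_eq_inner_single, ContinuousLinearMap.adjoint_inner_right, this, inner_zero_left]

lemma adjoint_lpRestrict_single {α β : Type*} [DecidableEq α] [DecidableEq β] (g : α → β)
    (hg : Function.Injective g) (x : α) :
    (lpRestrict g hg).adjoint (lp.single 2 x 1) = lp.single 2 (g x) 1 := by
  ext y
  by_cases hy : y ∈ Set.range g
  · obtain ⟨x', rfl⟩ := hy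
    rw [adjoint_lpRestrict_apply_of_eq]
    simp [Pi.single_apply, hg.eq_iff]
  · rw [adjoint_lpRestrict_apply_of_notMem _ _ _ _ hy]
    have : y ≠ g x := fun h => hy ⟨x, h.symm⟩
    simp [this]

/-- Restriction of a function on `Γ × G` to the fiber over `u`. -/
noncomputable def fiberRestrict (Γ : Type*) {G : Type*} (u : G) :
    lp (fun _ : Γ × G => ℂ) 2 →L[ℂ] lp (fun _ : Γ => ℂ) 2 :=
  lpRestrict (fun x => (x, u)) (Prod.mk_left_injective u)

lemma adjoint_fiberRestrict_apply {Γ G : Type*} [DecidableEq Γ] [DecidableEq G] (u v : G)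
    (f : lp (fun _ : Γ => ℂ) 2) (x : Γ) :
    (fiberRestrict Γ u).adjoint f (x, v) = if v = u then f x else 0 := by
  split_ifs with h
  · subst h
    exact adjoint_lpRestrict_apply_of_eq _ (Prod.mk_left_injective v) f x
  · exact adjoint_lpRestrict_apply_of_notMem _ _ _ _ (by simp [Ne.symm h])

/-- Operators on `ℓ²(Γ × G)` as `G × G` matrices of operators on `ℓ²(Γ)`. -/
noncomputable def fiberBlocks (Γ G : Type*) [DecidableEq Γ] [Fintype G] [DecidableEq G] :
    (lp (fun _ : Γ × G => ℂ) 2 →L[ℂ] lp (fun _ : Γ × G => ℂ) 2) ≃*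
      Matrix G G (lp (fun _ : Γ => ℂ) 2 →L[ℂ] lp (fun _ : Γ => ℂ) 2) :=
  blockMulEquiv (fun u => (fiberRestrict Γ u).adjoint) (fun u => fiberRestrict Γ u)
    (fun u v => by
      ext f x
      have : (fiberRestrict Γ u ((fiberRestrict Γ v).adjoint f)) x = _ :=
        adjoint_fiberRestrict_apply v u f x
      split_ifs at this ⊢ with h <;> simpa using this)
    (by
      ext f ⟨x, v⟩
      simp only [sum_apply, ContinuousLinearMap.comp_apply, lp.coeFn_sum,
        Finset.sum_apply, adjoint_fiberRestrict_apply]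
      simp [fiberRestrict])

lemma fiberBlocks_apply {Γ G : Type*} [DecidableEq Γ] [Fintype G] [DecidableEq G]
    (X : lp (fun _ : Γ × G => ℂ) 2 →L[ℂ] lp (fun _ : Γ × G => ℂ) 2) (u v : G) :
    fiberBlocks Γ G X u v = fiberRestrict Γ u ∘L X ∘L (fiberRestrict Γ v).adjoint := rfl

lemma adjoint_fiberRestrict_single {Γ G : Type*} [DecidableEq Γ] [DecidableEq G] (u : G) (x : Γ) :
    (fiberRestrict Γ u).adjoint (lp.single 2 x 1) = lp.single 2 (x, u) 1 :=
  adjoint_lpRestrict_single _ (Prod.mk_left_injective u) x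

lemma fiberBlocks_sub_algebraMap {Γ G : Type*} [DecidableEq Γ] [Fintype G] [DecidableEq G]
    (O : G) (Ho : lp (fun _ : Γ => ℂ) 2 →L[ℂ] lp (fun _ : Γ => ℂ) 2) (a : Matrix G G ℂ)
    (H : lp (fun _ : Γ × G => ℂ) 2 →L[ℂ] lp (fun _ : Γ × G => ℂ) 2)
    (hmat : ∀ (x y : Γ) (u v : G),
      ⟪lp.single 2 (x, u) (1 : ℂ), H (lp.single 2 (y, v) 1)⟫_ℂ
        = (if u = O then (1 : ℂ) else 0) * (if v = O then (1 : ℂ) else 0) *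
            ⟪lp.single 2 x (1 : ℂ), Ho (lp.single 2 y 1)⟫_ℂ
          + (if x = y then (1 : ℂ) else 0) * a u v) (z : ℂ) :
    fiberBlocks Γ G (H - algebraMap ℂ _ z) =
      (a - Matrix.scalar G z).map (algebraMap ℂ _) + Matrix.single O O Ho := by
  ext1 u v
  refine lp.ext_continuousLinearMap ENNReal.ofNat_ne_top fun y => ?_
  ext1
  ext x
  simp only [ContinuousLinearMap.comp_apply, lp.singleContinuousLinearMap_apply, fiberBlocks_apply,
    adjoint_fiberRestrict_single]
  rw [fiberRestrict, lpRestrict_apply, lp_apply_eq_inner_single, sub_apply, inner_sub_right, hmat,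
    ← lp_apply_eq_inner_single, ← lp_apply_eq_inner_single]
  simp only [Algebra.algebraMap_eq_smul_one, Matrix.add_apply, Matrix.map_apply, Matrix.sub_apply,
    Matrix.scalar_apply, Matrix.diagonal_apply, Matrix.single_apply, add_apply, smul_apply,
    one_apply_eq_self, lp.coeFn_add, lp.coeFn_smul, Pi.add_apply, Pi.smul_apply,
    lp.single_apply, Pi.single_apply, Prod.mk.injEq, smul_eq_mul]
  by_cases hu : u = O <;> by_cases hv : v = O <;> by_cases hxy : x = y <;> by_cases huv : u = v <;>
    simp [hu, hv, hxy, huv, eq_comm (a := O)] <;> ring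

lemma eq_zero_of_hasEigenvector_of_cyclic {V : Type*} [NormedAddCommGroup V]
    [InnerProductSpace ℂ V] [CompleteSpace V] {A : V →L[ℂ] V} (hA : IsSelfAdjoint A) {e x : V}
    (hcyc : Submodule.span ℂ (Set.range fun k : ℕ => (A ^ k) e) = ⊤) {z : ℂ} (hx : A x = z • x)
    (hex : ⟪e, x⟫_ℂ = 0) : x = 0 := by
  have hpow (k : ℕ) : (A ^ k) x = z ^ k • x := by
    induction k with
    | zero => simp
    | succ k ih => rw [pow_succ', mul_apply_eq_comp, ih, map_smul, hx, smul_smul, pow_succ]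
  have hmem : x ∈ (Submodule.span ℂ (Set.range fun k : ℕ => (A ^ k) e))ᗮ := by
    rw [Submodule.mem_orthogonal]
    intro u hu
    induction hu using Submodule.span_induction with
    | mem u hu =>
      obtain ⟨k, rfl⟩ := hu
      have := (hA.pow k).isSymmetric e x
      simp only [ContinuousLinearMap.coe_coe] at this
      rw [this, hpow, inner_smul_right, hex, mul_zero]
    | zero => simp
    | add u v _ _ hu hv => rw [inner_add_left, hu, hv, add_zero]
    | smul c u _ hu => rw [inner_smul_left, hu, mul_zero]
  rw [hcyc, Submodule.top_orthogonal_eq_bot] at hmem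
  simpa using hmem

lemma det_ne_zero_of_adjugate_eq_zero_of_cyclic {G : Type*} [Fintype G] [DecidableEq G] (O : G)
    (a : Matrix G G ℂ) (ha : IsSelfAdjoint (Matrix.toEuclideanCLM (𝕜 := ℂ) a))
    (hcyc : Submodule.span ℂ (Set.range fun k : ℕ =>
      (Matrix.toEuclideanCLM (𝕜 := ℂ) a ^ k) (EuclideanSpace.single O (1 : ℂ))) = ⊤) (z : ℂ)
    (hadj : (a - Matrix.scalar G z).adjugate O O = 0) : (a - Matrix.scalar G z).det ≠ 0 := by
  set A := Matrix.toEuclideanCLM (𝕜 := ℂ) a with hAdef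
  have hAx (x : G → ℂ) : A (WithLp.toLp 2 x) =
      WithLp.toLp 2 ((a - Matrix.scalar G z).mulVec x) + z • WithLp.toLp 2 x := by
    ext i
    simp [hAdef, Matrix.sub_mulVec]
  have key (x : G → ℂ) (hx : (a - Matrix.scalar G z).mulVec x = 0) (hxO : x O = 0) : x = 0 := by
    have := eq_zero_of_hasEigenvector_of_cyclic ha hcyc (x := WithLp.toLp 2 x) (z := z)
      (by rw [hAx, hx]; simp) (by simpa [EuclideanSpace.inner_single_left] using hxO)
    simpa using this
  intro hdet
  obtain ⟨y, hy0, hy⟩ := Matrix.exists_mulVec_eq_zero_iff.2 hdet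
  have hyO : y O ≠ 0 := fun h => hy0 (key y hy h)
  have hAy : A (WithLp.toLp 2 y) = z • WithLp.toLp 2 y := by rw [hAx, hy]; simp
  have hz : (starRingEnd ℂ) z = z := by
    refine ha.isSymmetric.conj_eigenvalue_eq_self
      (Module.End.hasEigenvalue_of_hasEigenvector (x := WithLp.toLp 2 y) ⟨?_, by simpa using hy0⟩)
    rw [Module.End.mem_eigenspace_iff]
    exact hAy
  rw [Matrix.adjugate_apply] at hadj
  obtain ⟨x, hx0, hx⟩ := Matrix.exists_mulVec_eq_zero_iff.2 hadj
  have hxO : x O = 0 := by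
    have := congrFun hx O
    simpa [Matrix.mulVec] using this
  have hxi (i : G) (hi : i ≠ O) : (a - Matrix.scalar G z).mulVec x i = 0 := by
    have := congrFun hx i
    simpa [Matrix.mulVec, Matrix.updateRow_ne hi] using this
  obtain ⟨l, hl⟩ : ∃ l, (a - Matrix.scalar G z).mulVec x = Pi.single O l := by
    refine ⟨(a - Matrix.scalar G z).mulVec x O, funext fun i => ?_⟩
    by_cases hi : i = O
    · subst hi; simp
    · rw [hxi i hi, Pi.single_eq_of_ne hi]
  have hsym := ha.isSymmetric (WithLp.toLp 2 y) (WithLp.toLp 2 x)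
  simp only [ContinuousLinearMap.coe_coe] at hsym
  rw [hAy, hAx, hl, inner_add_right, inner_smul_left, inner_smul_right, hz, right_eq_add,
    show WithLp.toLp 2 (Pi.single O l) = EuclideanSpace.single O l from rfl,
    EuclideanSpace.inner_single_right] at hsym
  have hl0 : l = 0 := by simpa [hyO] using hsym
  exact hx0 (key x (by rw [hl, hl0, Pi.single_zero]) hxO)

lemma add_sum_div_sub_ne_zero {n : ℕ} (c : ℝ) (ε w : Fin n → ℝ) (hw : ∀ j, 0 < w j) {z : ℂ}
    (hz : z.im ≠ 0) : z + (c : ℂ) + ∑ j, (w j : ℂ) / ((ε j : ℂ) - z) ≠ 0 := by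
  intro h
  have him := congrArg Complex.im h
  have hterm (j : Fin n) : ((w j : ℂ) / ((ε j : ℂ) - z)).im =
      z.im * (w j / Complex.normSq ((ε j : ℂ) - z)) := by
    rw [Complex.div_im]
    simp
    ring
  simp only [Complex.add_im, Complex.im_sum, hterm, ← Finset.mul_sum, Complex.ofReal_im, add_zero,
    Complex.zero_im] at him
  have hpos : 0 ≤ ∑ j, w j / Complex.normSq ((ε j : ℂ) - z) :=
    Finset.sum_nonneg fun j _ => div_nonneg (hw j).le (Complex.normSq_nonneg _)
  have : z.im * (1 + ∑ j, w j / Complex.normSq ((ε j : ℂ) - z)) = 0 := by linarith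
  rcases mul_eq_zero.1 this with h | h
  · exact hz h
  · linarith

lemma dense_im_ne_zero : Dense {z : ℂ | z.im ≠ 0} := by
  have := (dense_compl_singleton (0 : ℝ)).preimage Complex.isOpenMap_im
  exact this

lemma prod_sub_mul_sum_div {n : ℕ} (ε w : Fin n → ℂ) (s z : ℂ) (hz : ∀ j, z ≠ ε j) :
    (∏ j, (ε j - z)) * (s + ∑ j, w j / (ε j - z)) =
      s * ∏ j, (ε j - z) + ∑ j, w j * ∏ i ∈ Finset.univ.erase j, (ε i - z) := by
  rw [mul_add, mul_comm, Finset.mul_sum]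
  congr 1
  refine Finset.sum_congr rfl fun j _ => ?_
  rw [← Finset.mul_prod_erase _ _ (Finset.mem_univ j)]
  have := sub_ne_zero.2 (hz j).symm
  field_simp

lemma neg_det_mul_prod_eq_adjugate_mul {G : Type*} [Fintype G] [DecidableEq G] (O : G)
    (a : Matrix G G ℂ) (c : ℝ) (n : ℕ) (ε w : Fin n → ℝ) (hw : ∀ j, 0 < w j)
    (hpf : ∀ z : ℂ, z.im ≠ 0 →
      -(⟪EuclideanSpace.single O (1 : ℂ), (Ring.inverse
          (Matrix.toEuclideanCLM (𝕜 := ℂ) a - z • 1)) (EuclideanSpace.single O 1)⟫_ℂ)⁻¹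
        = z + (c : ℂ) + ∑ j, (w j : ℂ) / ((ε j : ℂ) - z)) (z : ℂ) :
    -(a - Matrix.scalar G z).det * ∏ j, ((ε j : ℂ) - z) =
      (a - Matrix.scalar G z).adjugate O O * ((z + c) * ∏ j, ((ε j : ℂ) - z) +
        ∑ j, (w j : ℂ) * ∏ i ∈ Finset.univ.erase j, ((ε i : ℂ) - z)) := by
  have hcont : Continuous fun z : ℂ => a - Matrix.scalar G z := by
    refine continuous_const.sub (continuous_matrix fun i j => ?_)
    by_cases hij : i = j <;> simp [hij, continuous_id', continuous_const]
  refine congrFun (Continuous.ext_on (s := {z : ℂ | z.im ≠ 0}) dense_im_ne_zero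
    (f := fun z : ℂ => -(a - Matrix.scalar G z).det * ∏ j, ((ε j : ℂ) - z))
    (g := fun z : ℂ => (a - Matrix.scalar G z).adjugate O O * ((z + c) * ∏ j, ((ε j : ℂ) - z) +
        ∑ j, (w j : ℂ) * ∏ i ∈ Finset.univ.erase j, ((ε i : ℂ) - z))) ?_ ?_ ?_) z
  · exact hcont.matrix_det.neg.mul (by fun_prop)
  · exact (hcont.matrix_adjugate.matrix_elem O O).mul (by fun_prop)
  intro z hz
  have hzε (j : Fin n) : z ≠ ε j := by
    rintro rfl
    simp at hz
  have hne := add_sum_div_sub_ne_zero c ε w hw hz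
  have hm := hpf z hz
  set B := Matrix.toEuclideanCLM (𝕜 := ℂ) a - z • 1 with hB
  set y := Ring.inverse B (EuclideanSpace.single O 1) with hy
  rw [← hm, neg_ne_zero, Ne, inv_eq_zero] at hne
  have hBu : IsUnit B := by
    by_contra h
    rw [hy, Ring.inverse_non_unit _ h] at hne
    simp at hne
  have hBy : B y = EuclideanSpace.single O 1 := by
    rw [hy, ← mul_apply_eq_comp, Ring.mul_inverse_cancel _ hBu, one_apply_eq_self]
  have hvec : (a - Matrix.scalar G z).mulVec y = Pi.single O 1 := by
    have h := congrArg WithLp.ofLp hBy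
    rw [show WithLp.ofLp (EuclideanSpace.single O (1 : ℂ)) = Pi.single O 1 from rfl] at h
    rw [← h]
    ext i
    simp [hB, Matrix.sub_mulVec]
  have hcramer : (a - Matrix.scalar G z).det * y O = (a - Matrix.scalar G z).adjugate O O := by
    have h := congrFun (congrArg (a - Matrix.scalar G z).adjugate.mulVec hvec) O
    rw [Matrix.mulVec_mulVec, Matrix.adjugate_mul] at h
    simpa [Matrix.smul_mulVec] using h
  have hyO : ⟪EuclideanSpace.single O (1 : ℂ), y⟫_ℂ = y O := by
    simp [EuclideanSpace.inner_single_left]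
  rw [hyO] at hm hne
  simp only
  rw [← prod_sub_mul_sum_div _ _ _ _ hzε, ← hm, ← hcramer]
  field_simp

/- Context: `Γ` is a nonempty countable set, `G` a nonempty finite set, `O ∈ G`.
`ℓ²(Γ)` is formalized as `lp (fun _ : Γ => ℂ) 2` with standard basis vectors
`lp.single 2 x 1`, and `ℓ²(G)` as `EuclideanSpace ℂ G` with standard basis vectors
`EuclideanSpace.single u 1`.  `H_o` is a bounded self-adjoint operator on `ℓ²(Γ)`,
`A` a self-adjoint operator on `ℓ²(G)`, and the decorated Hamiltonian `H` is the
bounded self-adjoint operator on `ℓ²(Γ × G)` determined by the matrix elements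
`⟪δ_{(x,u)}, H δ_{(y,v)}⟫ = [u = O]·[v = O]·⟪δ_x, H_o δ_y⟫ + [x = y]·⟪δ_u, A δ_v⟫`.
Resolvents `(B - z)⁻¹` are expressed as `Ring.inverse (B - z • 1)`, which agrees
with the resolvent whenever `z ∉ σ(B)`. -/
/-- Assume additionally that `δ_O` is a cyclic vector for `A`, i.e.
the linear span of `{A^k δ_O : k ∈ ℕ}` is all of `ℓ²(G)`.  Then
`σ(H) = { E ∈ ℝ : E ∉ {ε_1, …, ε_n} and γ(E) ∈ σ(H_o) }`, where
`γ(E) = E + c + Σ_j w_j/(ε_j − E)` comes from a partial fraction decomposition of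
`−1/m(z)` as in the context. -/
theorem statement5
    {Γ : Type*} [Countable Γ] [Nonempty Γ] [DecidableEq Γ]
    {G : Type*} [Fintype G] [Nonempty G] [DecidableEq G]
    (O : G)
    (Ho : lp (fun _ : Γ => ℂ) 2 →L[ℂ] lp (fun _ : Γ => ℂ) 2)
    (hHo : IsSelfAdjoint Ho)
    (A : EuclideanSpace ℂ G →L[ℂ] EuclideanSpace ℂ G)
    (hA : IsSelfAdjoint A)
    (H : lp (fun _ : Γ × G => ℂ) 2 →L[ℂ] lp (fun _ : Γ × G => ℂ) 2)
    (hH : IsSelfAdjoint H)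
    (hmat : ∀ (x y : Γ) (u v : G),
      ⟪lp.single 2 (x, u) (1 : ℂ), H (lp.single 2 (y, v) 1)⟫_ℂ
        = (if u = O then (1 : ℂ) else 0) * (if v = O then (1 : ℂ) else 0) *
            ⟪lp.single 2 x (1 : ℂ), Ho (lp.single 2 y 1)⟫_ℂ
          + (if x = y then (1 : ℂ) else 0) *
            ⟪EuclideanSpace.single u (1 : ℂ), A (EuclideanSpace.single v 1)⟫_ℂ)
    (c : ℝ) (n : ℕ) (ε : Fin n → ℝ) (w : Fin n → ℝ)
    (hε : Function.Injective ε) (hw : ∀ j, 0 < w j)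
    (hpf : ∀ z : ℂ, z.im ≠ 0 →
      -(⟪EuclideanSpace.single O (1 : ℂ),
          (Ring.inverse (A - z • 1)) (EuclideanSpace.single O 1)⟫_ℂ)⁻¹
        = z + (c : ℂ) + ∑ j, (w j : ℂ) / ((ε j : ℂ) - z))
    (hcyc : Submodule.span ℂ
        (Set.range fun k : ℕ => (A ^ k) (EuclideanSpace.single O (1 : ℂ))) = ⊤) :
    spectrum ℂ H
      = (fun E : ℝ => (E : ℂ)) ''
          {E : ℝ | (∀ j, E ≠ ε j) ∧
            ((E + c + ∑ j, w j / (ε j - E) : ℝ) : ℂ) ∈ spectrum ℂ Ho} := by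
  obtain ⟨a, rfl⟩ := (Matrix.toEuclideanCLM (n := G) (𝕜 := ℂ)).surjective A
  have hcop := det_ne_zero_of_adjugate_eq_zero_of_cyclic O a hA hcyc
  have hid := neg_det_mul_prod_eq_adjugate_mul O a c n ε w hw hpf
  have hentry (u v : G) : ⟪EuclideanSpace.single u (1 : ℂ),
      Matrix.toEuclideanCLM (𝕜 := ℂ) a (EuclideanSpace.single v 1)⟫_ℂ = a u v := by
    simp [EuclideanSpace.inner_single_left]
  have hmat' := fun (x y : Γ) (u v : G) => (hmat x y u v).trans
    (congrArg (fun t => _ + (if x = y then (1 : ℂ) else 0) * t) (hentry u v))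
  have hunit (z : ℂ) : IsUnit (H - algebraMap ℂ _ z) ↔
      IsUnit (algebraMap ℂ (lp (fun _ : Γ => ℂ) 2 →L[ℂ] lp (fun _ : Γ => ℂ) 2)
        (a - Matrix.scalar G z).det + (a - Matrix.scalar G z).adjugate O O • Ho) := by
    rw [← isUnit_map_add_single_iff _ _ _ (hcop z), ← fiberBlocks_sub_algebraMap O Ho a H hmat',
      MulEquiv.isUnit_map]
  have hpole (j : Fin n) : (a - Matrix.scalar G (ε j : ℂ)).adjugate O O = 0 := by
    have h := hid (ε j)
    have hprod : ∏ i, ((ε i : ℂ) - ε j) = 0 :=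
      Finset.prod_eq_zero (Finset.mem_univ j) (sub_self _)
    rw [hprod, mul_zero, mul_zero, zero_add, Finset.sum_eq_single j, eq_comm, mul_eq_zero] at h
    · refine h.resolve_right (mul_ne_zero (by exact_mod_cast (hw j).ne') ?_)
      rw [Finset.prod_ne_zero_iff]
      intro i hi
      rw [sub_ne_zero]
      exact_mod_cast hε.ne (Finset.ne_of_mem_erase hi)
    · intro k _ hk
      rw [Finset.prod_eq_zero (Finset.mem_erase.2 ⟨hk.symm, Finset.mem_univ j⟩) (sub_self _),
        mul_zero]
    · simp
  have hspec (E : ℝ) : (E : ℂ) ∈ spectrum ℂ H ↔ (∀ j, E ≠ ε j) ∧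
      ((E + c + ∑ j, w j / (ε j - E) : ℝ) : ℂ) ∈ spectrum ℂ Ho := by
    rw [spectrum.mem_iff, spectrum.mem_iff, IsUnit.sub_iff, hunit]
    by_cases hE : ∀ j, E ≠ ε j
    · have hE' (j : Fin n) : (E : ℂ) ≠ ε j := by exact_mod_cast hE j
      have hprod : ∏ j, ((ε j : ℂ) - E) ≠ 0 :=
        Finset.prod_ne_zero_iff.2 fun j _ => sub_ne_zero.2 (hE' j).symm
      have h := hid E
      rw [← prod_sub_mul_sum_div _ _ _ _ hE'] at h
      set γ : ℂ := (E : ℂ) + c + ∑ j, (w j : ℂ) / ((ε j : ℂ) - E) with hγ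
      have hdet : (a - Matrix.scalar G (E : ℂ)).det =
          -((a - Matrix.scalar G (E : ℂ)).adjugate O O * γ) := by
        apply mul_right_cancel₀ hprod
        linear_combination -h
      have hQ : (a - Matrix.scalar G (E : ℂ)).adjugate O O ≠ 0 := by
        intro h0
        exact hcop _ h0 (by rw [hdet, h0, zero_mul, neg_zero])
      have hcast : ((E + c + ∑ j, w j / (ε j - E) : ℝ) : ℂ) = γ := by
        rw [hγ]
        push_cast
        rfl
      have hfactor : algebraMap ℂ (lp (fun _ : Γ => ℂ) 2 →L[ℂ] lp (fun _ : Γ => ℂ) 2)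
          (a - Matrix.scalar G (E : ℂ)).det + (a - Matrix.scalar G (E : ℂ)).adjugate O O • Ho =
          (Units.mk0 _ hQ) • (Ho - algebraMap ℂ _ γ) := by
        rw [Units.smul_mk0, hdet, smul_sub, Algebra.algebraMap_eq_smul_one,
          Algebra.algebraMap_eq_smul_one, smul_smul, neg_smul]
        abel
      rw [hfactor, isUnit_smul_iff, hcast, IsUnit.sub_iff]
      simp [hE]
    · simp only [hE, false_and, iff_false, not_not]
      push Not at hE
      obtain ⟨j, rfl⟩ := hE
      rw [hpole j, zero_smul, add_zero]
      exact (IsUnit.mk0 _ (hcop _ (hpole j))).map (algebraMap ℂ _)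
  ext z
  constructor
  · intro hz
    have hre := hH.mem_spectrum_eq_re hz
    rw [hre] at hz
    exact ⟨z.re, (hspec z.re).1 hz, hre.symm⟩
  · rintro ⟨E, hE, rfl⟩
    exact (hspec E).2 hE
end

section
/- In any decomposition −1/m(z) = z + c + Σ_{j=1}^n w_j/(ε_j − z) (valid for all z ∈ ℂ ∖ ℝ, with c ∈ ℝ, pairwise distinct reals ε_j, and w_j > 0), the constant term satisfies c = −⟨φ, A φ⟩. -/
open scoped InnerProductSpace

open Filter Topology

lemma Ring.inverse_sub_smul_one {R : Type*} [Ring R] [Algebra ℂ R] (a : R) {z : ℂ} (hz : z ≠ 0)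
    (h : IsUnit (1 - z⁻¹ • a)) :
    Ring.inverse (a - z • 1) = -(z⁻¹ • Ring.inverse (1 - z⁻¹ • a)) := by
  have key : a - z • 1 = -(z • (1 - z⁻¹ • a)) := by
    rw [smul_sub, smul_inv_smul₀ hz, neg_sub]
  let U : Rˣ :=
    { val := a - z • 1
      inv := -(z⁻¹ • Ring.inverse (1 - z⁻¹ • a))
      val_inv := by
        rw [key, neg_mul_neg, smul_mul_smul_comm, Ring.mul_inverse_cancel _ h,
          mul_inv_cancel₀ hz, one_smul]
      inv_val := by
        rw [key, neg_mul_neg, smul_mul_smul_comm, Ring.inverse_mul_cancel _ h,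
          inv_mul_cancel₀ hz, one_smul] }
  exact Ring.inverse_unit U

lemma tendsto_ringInverse_one_sub_smul {R ι : Type*} [NormedRing R] [NormedAlgebra ℂ R]
    [CompleteSpace R] (a : R) {l : Filter ι} {s : ι → ℂ} (hs : Tendsto s l (𝓝 0)) :
    (∀ᶠ t in l, IsUnit (1 - s t • a)) ∧
      Tendsto (fun t => Ring.inverse (1 - s t • a)) l (𝓝 1) := by
  have h : Tendsto (fun t => 1 - s t • a) l (𝓝 1) := by
    simpa using (hs.smul_const a).const_sub 1
  refine ⟨h (Units.isOpen.mem_nhds isUnit_one), ?_⟩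
  have hc := NormedRing.inverse_continuousAt (1 : Rˣ)
  rw [ContinuousAt, Units.val_one, Ring.inverse_one] at hc
  exact hc.comp h

/-- The constant term at infinity of the expansion of `-1/m`. -/
lemma tendsto_neg_inv_inner_resolvent_sub {V ι : Type*} [NormedAddCommGroup V]
    [InnerProductSpace ℂ V] [CompleteSpace V] (A : V →L[ℂ] V) {φ : V} (hφ : ‖φ‖ = 1)
    {l : Filter ι} {z : ι → ℂ} (hz : Tendsto z l (Bornology.cobounded ℂ)) :
    Tendsto (fun t => -(⟪φ, (Ring.inverse (A - z t • 1)) φ⟫_ℂ)⁻¹ - z t) l (𝓝 (-⟪φ, A φ⟫_ℂ)) := by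
  have hs : Tendsto (fun t => (z t)⁻¹) l (𝓝 0) := tendsto_inv₀_cobounded.comp hz
  obtain ⟨hu, hB⟩ := tendsto_ringInverse_one_sub_smul A hs
  have hp : Tendsto (fun t => ⟪φ, Ring.inverse (1 - (z t)⁻¹ • A) φ⟫_ℂ) l (𝓝 1) := by
    have : Continuous fun T : V →L[ℂ] V => ⟪φ, T φ⟫_ℂ := by fun_prop
    simpa [Function.comp_def, inner_self_eq_norm_sq_to_K, hφ] using (this.tendsto 1).comp hB
  have hq : Tendsto (fun t => ⟪φ, A (Ring.inverse (1 - (z t)⁻¹ • A) φ)⟫_ℂ) l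
      (𝓝 ⟪φ, A φ⟫_ℂ) := by
    have : Continuous fun T : V →L[ℂ] V => ⟪φ, A (T φ)⟫_ℂ := by fun_prop
    simpa [Function.comp_def] using (this.tendsto 1).comp hB
  have hlim := (hq.div hp one_ne_zero).neg
  rw [div_one] at hlim
  refine hlim.congr' ?_
  filter_upwards [hu, hp.eventually_ne one_ne_zero, hz.eventually_ne_cobounded 0]
    with t hut hpt hzt
  have hres := congrArg (fun T : V →L[ℂ] V => ⟪φ, T φ⟫_ℂ) (Ring.mul_inverse_cancel _ hut)
  rw [Ring.inverse_sub_smul_one A hzt hut]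
  simp only [mul_apply_eq_comp, sub_apply,
    one_apply_eq_self, smul_apply, inner_sub_right,
    inner_smul_right, inner_self_eq_norm_sq_to_K, hφ] at hres
  simp only [neg_apply, smul_apply, inner_neg_right,
    inner_smul_right, Pi.div_apply]
  generalize ⟪φ, Ring.inverse (1 - (z t)⁻¹ • A) φ⟫_ℂ = p at *
  generalize ⟪φ, A (Ring.inverse (1 - (z t)⁻¹ • A) φ)⟫_ℂ = q at *
  simp only [RCLike.ofReal_one, one_pow] at hres
  field_simp at hres ⊢
  linear_combination hres

/-- Let `V` be a nonzero finite-dimensional complex inner product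
space, `A` a self-adjoint operator on `V`, `φ` a unit vector, and
`m(z) = ⟪φ, (A − z)⁻¹ φ⟫` (the resolvent is expressed via `Ring.inverse`).  In any
decomposition `−1/m(z) = z + c + Σ_{j=1}^n w_j/(ε_j − z)` (valid for all nonreal `z`,
with `c ∈ ℝ`, pairwise distinct reals `ε_j`, and `w_j > 0`), the constant term
satisfies `c = −⟪φ, A φ⟫`. -/
theorem statement8
    {V : Type*} [NormedAddCommGroup V] [InnerProductSpace ℂ V]
    [FiniteDimensional ℂ V] [Nontrivial V]
    (A : V →L[ℂ] V) (hA : IsSelfAdjoint A)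
    (φ : V) (hφ : ‖φ‖ = 1)
    (c : ℝ) (n : ℕ) (ε : Fin n → ℝ) (w : Fin n → ℝ)
    (hε : Function.Injective ε) (hw : ∀ j, 0 < w j)
    (hpf : ∀ z : ℂ, z.im ≠ 0 →
      -(⟪φ, (Ring.inverse (A - z • 1)) φ⟫_ℂ)⁻¹
        = z + (c : ℂ) + ∑ j, (w j : ℂ) / ((ε j : ℂ) - z))
    : (c : ℂ) = -⟪φ, A φ⟫_ℂ := by
  have : CompleteSpace V := FiniteDimensional.complete ℂ V
  let z : ℝ → ℂ := fun t => t * Complex.I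
  have hz : Tendsto z atTop (Bornology.cobounded ℂ) := by
    rw [← tendsto_norm_atTop_iff_cobounded]
    simpa [z] using tendsto_abs_atTop_atTop
  have hlim := tendsto_neg_inv_inner_resolvent_sub A hφ hz
  have hsum : Tendsto (fun t => (c : ℂ) + ∑ j, (w j : ℂ) / ((ε j : ℂ) - z t)) atTop
      (𝓝 (c + ∑ _j : Fin n, 0)) := by
    refine (tendsto_finsetSum _ fun j _ => ?_).const_add _
    have h : Tendsto (fun t => (ε j : ℂ) - z t) atTop (Bornology.cobounded ℂ) :=
      (tendsto_const_sub_cobounded _).comp hz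
    simpa [div_eq_mul_inv] using (tendsto_inv₀_cobounded.comp h).const_mul (w j : ℂ)
  rw [Finset.sum_const_zero, add_zero] at hsum
  refine tendsto_nhds_unique (hsum.congr' ?_) hlim
  filter_upwards [eventually_ne_atTop 0] with t ht
  rw [hpf (z t) (by simpa [z] using ht)]
  ring
end

section
/- In any decomposition −1/m(z) = z + c + Σ_{j=1}^n w_j/(ε_j − z) (valid for all z ∈ ℂ ∖ ℝ, with c ∈ ℝ, pairwise distinct reals ε_j, and w_j > 0), the weights satisfy Σ_{j=1}^n w_j = ⟨φ, A² φ⟩ − ⟨φ, A φ⟩². -/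
open scoped InnerProductSpace

open Filter Topology

/-- The resolvent at `s⁻¹` in terms of the inverse of `1 - s • A`. -/
lemma Ring.inverse_sub_inv_smul_one {𝕜 R : Type*} [Field 𝕜] [Ring R] [Algebra 𝕜 R]
    {A : R} {s : 𝕜} (hs : s ≠ 0) (h : IsUnit (1 - s • A)) :
    Ring.inverse (A - s⁻¹ • 1) = (-s) • Ring.inverse (1 - s • A) := by
  have key : A - s⁻¹ • (1 : R) = (-s⁻¹) • (1 - s • A) := by
    rw [smul_sub, smul_smul, neg_mul, inv_mul_cancel₀ hs, neg_smul, neg_smul, one_smul]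
    abel
  have hc : (-s⁻¹) * (-s) = 1 := by field_simp
  have h₁ : (A - s⁻¹ • 1) * ((-s) • Ring.inverse (1 - s • A)) = 1 := by
    rw [key, smul_mul_smul_comm, Ring.mul_inverse_cancel _ h, hc, one_smul]
  have h₂ : ((-s) • Ring.inverse (1 - s • A)) * (A - s⁻¹ • 1) = 1 := by
    rw [key, smul_mul_smul_comm, Ring.inverse_mul_cancel _ h, mul_comm, hc, one_smul]
  exact Ring.inverse_unit ⟨_, _, h₁, h₂⟩

/-- Second-order Neumann expansion of the inverse of `1 - s • A` with exact remainder. -/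
lemma Ring.inverse_one_sub_smul_eq {𝕜 R : Type*} [Field 𝕜] [Ring R] [Algebra 𝕜 R]
    {A : R} {s : 𝕜} (h : IsUnit (1 - s • A)) :
    Ring.inverse (1 - s • A) = 1 + s • A + s ^ 2 • (A ^ 2 * Ring.inverse (1 - s • A)) := by
  set N := Ring.inverse (1 - s • A) with hN
  have h₁ : N = 1 + s • (A * N) := by
    have := Ring.mul_inverse_cancel _ h
    rw [← hN, sub_mul, one_mul, smul_mul_assoc] at this
    rw [← this]; abel
  have h₂ : A * N = A + s • (A ^ 2 * N) := by
    conv_lhs => rw [h₁]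
    rw [mul_add, mul_one, mul_smul_comm, pow_two, mul_assoc]
  conv_lhs => rw [h₁, h₂]
  rw [smul_add, smul_smul, pow_two s, add_assoc]

/-- Comparison of second-order coefficients in `(1 + a s + b s²) (1 + c s - W s²) = 1`
as `s → 0`, where `b` and `W` may depend on `s`. -/
lemma eq_sub_sq_of_mul_expansion_eq_one {𝕜 α : Type*} [NormedField 𝕜] {l : Filter α} [l.NeBot]
    {s b W : α → 𝕜} {a c b₀ W₀ : 𝕜} (hs : Tendsto s l (𝓝 0)) (hs' : ∀ᶠ t in l, s t ≠ 0)
    (hb : Tendsto b l (𝓝 b₀)) (hW : Tendsto W l (𝓝 W₀))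
    (h : ∀ᶠ t in l, (1 + a * s t + b t * s t ^ 2) * (1 + c * s t - W t * s t ^ 2) = 1) :
    W₀ = b₀ - a ^ 2 := by
  have hr : Tendsto (fun t => b t + a * c - W t + s t * (b t * c - a * W t)
      - s t ^ 2 * (b t * W t)) l (𝓝 (b₀ + a * c - W₀)) := by
    have := (((hb.add_const (a * c)).sub hW).add
      (hs.mul ((hb.mul_const c).sub (hW.const_mul a)))).sub ((hs.pow 2).mul (hb.mul hW))
    simpa using this
  have hac : a + c = 0 := by
    have h₁ := (hs.mul hr).const_add (a + c)
    rw [zero_mul, add_zero] at h₁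
    refine tendsto_nhds_unique (h₁.congr' ?_) tendsto_const_nhds
    filter_upwards [h, hs'] with t ht hst
    apply mul_left_cancel₀ hst
    linear_combination ht
  have h₂ : b₀ + a * c - W₀ = 0 := by
    refine tendsto_nhds_unique (hr.congr' ?_) tendsto_const_nhds
    filter_upwards [h, hs'] with t ht hst
    apply mul_left_cancel₀ (pow_ne_zero 2 hst)
    linear_combination ht - s t * hac
  linear_combination a * hac - h₂

/-- With the setup of Statement 8 (any partial fraction
decomposition `−1/m(z) = z + c + Σ_{j=1}^n w_j/(ε_j − z)` valid for all nonreal `z`),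
the weights satisfy `Σ_{j=1}^n w_j = ⟪φ, A² φ⟫ − ⟪φ, A φ⟫²`. -/
theorem statement9
    {V : Type*} [NormedAddCommGroup V] [InnerProductSpace ℂ V]
    [FiniteDimensional ℂ V] [Nontrivial V]
    (A : V →L[ℂ] V) (hA : IsSelfAdjoint A)
    (φ : V) (hφ : ‖φ‖ = 1)
    (c : ℝ) (n : ℕ) (ε : Fin n → ℝ) (w : Fin n → ℝ)
    (hε : Function.Injective ε) (hw : ∀ j, 0 < w j)
    (hpf : ∀ z : ℂ, z.im ≠ 0 →
      -(⟪φ, (Ring.inverse (A - z • 1)) φ⟫_ℂ)⁻¹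
        = z + (c : ℂ) + ∑ j, (w j : ℂ) / ((ε j : ℂ) - z))
    : ((∑ j, w j : ℝ) : ℂ) = ⟪φ, (A ^ 2) φ⟫_ℂ - ⟪φ, A φ⟫_ℂ ^ 2 := by
  have : CompleteSpace V := FiniteDimensional.complete ℂ V
  let s : ℝ → ℂ := fun t => t * Complex.I
  let N : ℝ → V →L[ℂ] V := fun t => Ring.inverse (1 - s t • A)
  have hs : Tendsto s (𝓝[≠] 0) (𝓝 0) := by
    have : Continuous s := by fun_prop
    simpa [s] using (this.tendsto 0).mono_left nhdsWithin_le_nhds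
  have hs' : ∀ᶠ t in 𝓝[≠] (0 : ℝ), s t ≠ 0 := by
    filter_upwards [self_mem_nhdsWithin] with t ht
    simpa [s] using ht
  have hD : Tendsto (fun t => 1 - s t • A) (𝓝[≠] 0) (𝓝 1) := by
    simpa using (hs.smul_const A).const_sub 1
  have hunit : ∀ᶠ t in 𝓝[≠] (0 : ℝ), IsUnit (1 - s t • A) :=
    hD.eventually (Units.isOpen.mem_nhds isUnit_one)
  have hN : Tendsto N (𝓝[≠] 0) (𝓝 1) := by
    have := (NormedRing.inverse_continuousAt (1 : (V →L[ℂ] V)ˣ)).tendsto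
    rw [Units.val_one, Ring.inverse_one] at this
    exact this.comp hD
  have hφφ : ⟪φ, φ⟫_ℂ = 1 := by simp [inner_self_eq_norm_sq_to_K, hφ]
  have hinner : ∀ B : V →L[ℂ] V,
      Tendsto (fun t => ⟪φ, (B * N t) φ⟫_ℂ) (𝓝[≠] 0) (𝓝 ⟪φ, B φ⟫_ℂ) := by
    intro B
    have hc : Continuous fun T : V →L[ℂ] V => ⟪φ, (B * T) φ⟫_ℂ := by fun_prop
    simpa [Function.comp_def] using (hc.tendsto 1).comp hN
  have hW : Tendsto (fun t => ∑ j, (w j : ℂ) / (1 - s t * ε j)) (𝓝[≠] 0)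
      (𝓝 ((∑ j, w j : ℝ) : ℂ)) := by
    have : Tendsto (fun t => ∑ j, (w j : ℂ) / (1 - s t * ε j)) (𝓝[≠] 0)
        (𝓝 (∑ j, (w j : ℂ) / (1 - 0 * ε j))) :=
      tendsto_finsetSum _ fun j _ =>
        tendsto_const_nhds.div ((hs.mul_const _).const_sub 1) (by simp)
    simpa using this
  refine eq_sub_sq_of_mul_expansion_eq_one (c := (c : ℂ)) hs hs' (hinner (A ^ 2)) hW ?_
  have hf : ∀ᶠ t in 𝓝[≠] (0 : ℝ), ⟪φ, N t φ⟫_ℂ ≠ 0 := by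
    have := hinner 1
    simp only [one_mul, one_apply_eq_self, hφφ] at this
    exact this.eventually_ne one_ne_zero
  filter_upwards [hs', hunit, hf] with t hst hu hft
  have hexp : ⟪φ, N t φ⟫_ℂ
      = 1 + ⟪φ, A φ⟫_ℂ * s t + ⟪φ, (A ^ 2 * N t) φ⟫_ℂ * s t ^ 2 := by
    conv_lhs => rw [show N t = _ from Ring.inverse_one_sub_smul_eq hu]
    simp only [add_apply, smul_apply,
      one_apply_eq_self, inner_add_right, inner_smul_right, hφφ]
    ring
  have him : ((s t)⁻¹).im ≠ 0 := by
    have ht : t ≠ 0 := by rintro rfl; simp [s] at hst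
    simp [s, ht]
  have hz := hpf (s t)⁻¹ him
  rw [Ring.inverse_sub_inv_smul_one hst hu, smul_apply,
    inner_smul_right] at hz
  change -(-s t * ⟪φ, N t φ⟫_ℂ)⁻¹ = _ at hz
  have hsum : ∑ j, (w j : ℂ) / ((ε j : ℂ) - (s t)⁻¹)
      = -(s t * ∑ j, (w j : ℂ) / (1 - s t * ε j)) := by
    rw [Finset.mul_sum, ← Finset.sum_neg_distrib]
    refine Finset.sum_congr rfl fun j _ => ?_
    have hj : (ε j : ℂ) - (s t)⁻¹ = -((s t)⁻¹ * (1 - s t * ε j)) := by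
      field_simp
      ring
    rw [hj, div_neg, div_mul_eq_div_div, div_inv_eq_mul, mul_comm (w j : ℂ), mul_div_assoc]
  rw [hsum, neg_mul, inv_neg, neg_neg] at hz
  rw [← hexp]
  have hm : s t * ⟪φ, N t φ⟫_ℂ ≠ 0 := mul_ne_zero hst hft
  have h₁ := mul_inv_cancel₀ hm
  rw [hz] at h₁
  linear_combination h₁ - ⟪φ, N t φ⟫_ℂ * mul_inv_cancel₀ hst
end

section
/- In any decomposition −1/m(z) = z + c + Σ_{j=1}^n w_j/(ε_j − z) (valid for all z ∈ ℂ ∖ ℝ, with c ∈ ℝ, pairwise distinct reals ε_j, and w_j > 0), if for some index j additionally ε_j ∉ σ(A), then w_j = 1/⟨φ, (A − ε_j)⁻² φ⟩ = 1/‖(A − ε_j)⁻¹ φ‖². -/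
open scoped InnerProductSpace

open Filter Topology

/-- The resolvent `z ↦ (a - z)⁻¹` has derivative `(a - z)⁻²` off the spectrum. -/
theorem hasDerivAt_inverse_sub_smul_one {R : Type*} [NormedRing R] [NormedAlgebra ℂ R]
    [CompleteSpace R] {a : R} {z : ℂ} (hz : z ∉ spectrum ℂ a) :
    HasDerivAt (fun z : ℂ => Ring.inverse (a - z • 1)) (Ring.inverse (a - z • 1) ^ 2) z := by
  have hu : IsUnit (a - z • 1) := by
    rw [spectrum.notMem_iff, IsUnit.sub_iff, Algebra.algebraMap_eq_smul_one] at hz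
    exact hz
  obtain ⟨u, hu⟩ := hu
  have hf : HasDerivAt (fun z : ℂ => a - z • (1 : R)) (-1) z := by
    simpa using ((hasDerivAt_id z).smul_const (1 : R)).const_sub a
  have hinv := hasFDerivAt_ringInverse (𝕜 := ℂ) u
  rw [hu] at hinv
  have hval : Ring.inverse (a - z • 1) ^ 2 =
      (-ContinuousLinearMap.mulLeftRight ℂ R ↑u⁻¹ ↑u⁻¹) (-1) := by
    rw [← hu, Ring.inverse_unit]
    simp [sq]
  rw [hval]
  exact hinv.comp_hasDerivAt z hf

/-- If `1 / f` is asymptotically a simple pole with coefficient `-w` at `e`, then `f' = w⁻¹`. -/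
theorem HasDerivAt.eq_inv_of_tendsto_inv_mul {f : ℂ → ℂ} {f' e w : ℂ} {s : Set ℂ}
    (hf : HasDerivAt f f' e) (hw : w ≠ 0) (hs : e ∉ s) [NeBot (𝓝[s] e)]
    (h : Tendsto (fun z => (f z)⁻¹ * (z - e)) (𝓝[s] e) (𝓝 w)) : f' = w⁻¹ := by
  have hne : ∀ᶠ z in 𝓝[s] e, z - e ≠ 0 := by
    filter_upwards [self_mem_nhdsWithin] with z hz
    exact sub_ne_zero.2 fun h => hs (h ▸ hz)
  have hq : Tendsto (fun z => f z * (z - e)⁻¹) (𝓝[s] e) (𝓝 w⁻¹) :=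
    (h.inv₀ hw).congr fun z => by rw [mul_inv, inv_inv]
  have hsub : Tendsto (fun z => z - e) (𝓝[s] e) (𝓝 0) := by
    have : Tendsto (fun z => z - e) (𝓝 e) (𝓝 (e - e)) := tendsto_id.sub_const e
    rw [sub_self] at this
    exact this.mono_left nhdsWithin_le_nhds
  have hzero : f e = 0 := by
    refine tendsto_nhds_unique (l := 𝓝[s] e) (hf.continuousAt.tendsto.mono_left nhdsWithin_le_nhds) ?_
    rw [← mul_zero w⁻¹]
    refine (hq.mul hsub).congr' ?_
    filter_upwards [hne] with z hz
    rw [inv_mul_cancel_right₀ hz]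
  have hslope : Tendsto (slope f e) (𝓝[s] e) (𝓝 f') :=
    (hasDerivAt_iff_tendsto_slope.1 hf).mono_left
      (nhdsWithin_mono e fun z hz h => hs (h ▸ hz))
  refine tendsto_nhds_unique hslope (hq.congr fun z => ?_)
  rw [slope_def_field, hzero, sub_zero, div_eq_mul_inv]

/-- A partial fraction sum with distinct poles has residue `-w j` at the pole `ε j`. -/
theorem tendsto_add_sum_div_mul_sub {n : ℕ} (c : ℂ) (ε w : Fin n → ℂ)
    (hε : Function.Injective ε) (j : Fin n) :
    Tendsto (fun z => (z + c + ∑ i, w i / (ε i - z)) * (z - ε j)) (𝓝[≠] ε j) (𝓝 (-w j)) := by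
  have hreg : ContinuousAt (fun z =>
      (z + c + ∑ i ∈ Finset.univ.erase j, w i / (ε i - z)) * (z - ε j) - w j) (ε j) := by
    have hsum : ContinuousAt (fun z => ∑ i ∈ Finset.univ.erase j, w i / (ε i - z)) (ε j) := by
      refine tendsto_finsetSum _ fun i hi => ?_
      have hij : ε i - ε j ≠ 0 := sub_ne_zero.2 (hε.ne (Finset.ne_of_mem_erase hi))
      exact (continuousAt_const.div (continuousAt_const.sub continuousAt_id) hij)
    exact ((((continuousAt_id.add continuousAt_const).add hsum).mul
      (continuousAt_id.sub continuousAt_const)).sub continuousAt_const)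
  have ht := hreg.tendsto
  simp only [sub_self, mul_zero, zero_sub] at ht
  refine (ht.mono_left nhdsWithin_le_nhds).congr' ?_
  filter_upwards [self_mem_nhdsWithin] with z hz
  have hz' : ε j - z ≠ 0 := sub_ne_zero.2 (Ne.symm hz)
  rw [← Finset.add_sum_erase _ _ (Finset.mem_univ j)]
  field_simp
  ring

/-- With the setup of Statement 8 (any partial fraction
decomposition `−1/m(z) = z + c + Σ_{j=1}^n w_j/(ε_j − z)` valid for all nonreal `z`),
if for some index `j` additionally `ε_j ∉ σ(A)`, then
`w_j = 1/⟪φ, (A − ε_j)⁻² φ⟫ = 1/‖(A − ε_j)⁻¹ φ‖²` (resolvents expressed via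
`Ring.inverse`). -/
theorem statement10
    {V : Type*} [NormedAddCommGroup V] [InnerProductSpace ℂ V]
    [FiniteDimensional ℂ V] [Nontrivial V]
    (A : V →L[ℂ] V) (hA : IsSelfAdjoint A)
    (φ : V) (hφ : ‖φ‖ = 1)
    (c : ℝ) (n : ℕ) (ε : Fin n → ℝ) (w : Fin n → ℝ)
    (hε : Function.Injective ε) (hw : ∀ j, 0 < w j)
    (hpf : ∀ z : ℂ, z.im ≠ 0 →
      -(⟪φ, (Ring.inverse (A - z • 1)) φ⟫_ℂ)⁻¹
        = z + (c : ℂ) + ∑ j, (w j : ℂ) / ((ε j : ℂ) - z))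
    (j : Fin n) (hj : ((ε j : ℂ)) ∉ spectrum ℂ A) :
    (w j : ℂ) = 1 / ⟪φ, ((Ring.inverse (A - (ε j : ℂ) • 1)) ^ 2) φ⟫_ℂ ∧
    w j = 1 / ‖(Ring.inverse (A - (ε j : ℂ) • 1)) φ‖ ^ 2 := by
  have : CompleteSpace V := FiniteDimensional.complete ℂ V
  set e : ℂ := (ε j : ℂ) with he
  set R : V →L[ℂ] V := Ring.inverse (A - e • 1) with hR
  set s : Set ℂ := {z | 0 < z.im}
  have hs : e ∉ s := by simp [s, he]
  have : NeBot (𝓝[s] e) := by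
    rw [← mem_closure_iff_nhdsWithin_neBot, Complex.closure_setOfPred_lt_im]
    simp [he]
  have hderiv : HasDerivAt (fun z : ℂ => ⟪φ, Ring.inverse (A - z • 1) φ⟫_ℂ) ⟪φ, (R ^ 2) φ⟫_ℂ e :=
    ((innerSL ℂ φ).comp (ContinuousLinearMap.apply ℂ V φ)).hasFDerivAt.comp_hasDerivAt e
      (hasDerivAt_inverse_sub_smul_one hj)
  have hw0 : (w j : ℂ) ≠ 0 := Complex.ofReal_ne_zero.2 (hw j).ne'
  have hlim : Tendsto (fun z : ℂ => (⟪φ, Ring.inverse (A - z • 1) φ⟫_ℂ)⁻¹ * (z - e))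
      (𝓝[s] e) (𝓝 (w j : ℂ)) := by
    have h := (tendsto_add_sum_div_mul_sub (c : ℂ) (fun i => (ε i : ℂ)) (fun i => (w i : ℂ))
      (Complex.ofReal_injective.comp hε) j).neg
    rw [neg_neg] at h
    refine (h.mono_left (nhdsWithin_mono e fun z hz h =>
      hs ((Set.mem_singleton_iff.1 h).trans he.symm ▸ hz))).congr' ?_
    filter_upwards [self_mem_nhdsWithin] with z hz
    rw [← hpf z (ne_of_gt hz), neg_mul, neg_neg]
  have hinner : ⟪φ, (R ^ 2) φ⟫_ℂ = (w j : ℂ)⁻¹ := hderiv.eq_inv_of_tendsto_inv_mul hw0 hs hlim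
  have hRsa : star R = R := by
    rw [hR, ← Ring.inverse_star, star_sub, star_smul, star_one, hA.star_eq]
    simp [he]
  have hnorm : ⟪φ, (R ^ 2) φ⟫_ℂ = ((‖R φ‖ ^ 2 : ℝ) : ℂ) := by
    rw [sq, mul_apply_eq_comp, ← ContinuousLinearMap.adjoint_inner_left,
      ← ContinuousLinearMap.star_eq_adjoint, hRsa, inner_self_eq_norm_sq_to_K]
    norm_cast
  have hfst : (w j : ℂ) = 1 / ⟪φ, (R ^ 2) φ⟫_ℂ := by rw [hinner, one_div, inv_inv]
  refine ⟨hfst, ?_⟩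
  rw [hnorm] at hfst
  exact_mod_cast hfst
end

section
/- If δ_O is a cyclic vector for A, i.e., the linear span of {A^k δ_O : k ∈ ℕ} is all of ℓ²(G), then the family {δ_{(x,O)} : x ∈ Γ} is cyclic for H: the closed linear span of { H^k δ_{(x,O)} : k ∈ ℕ, x ∈ Γ } equals ℓ²(Γ × G). -/
open scoped InnerProductSpace

/- Context: `Γ` is a nonempty countable set, `G` a nonempty finite set, `O ∈ G`.
`ℓ²(Γ)` is formalized as `lp (fun _ : Γ => ℂ) 2` with standard basis vectors
`lp.single 2 x 1`, and `ℓ²(G)` as `EuclideanSpace ℂ G` with standard basis vectors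
`EuclideanSpace.single u 1`.  `H_o` is a bounded self-adjoint operator on `ℓ²(Γ)`,
`A` a self-adjoint operator on `ℓ²(G)`, and the decorated Hamiltonian `H` is the
bounded self-adjoint operator on `ℓ²(Γ × G)` determined by the matrix elements
`⟪δ_{(x,u)}, H δ_{(y,v)}⟫ = [u = O]·[v = O]·⟪δ_x, H_o δ_y⟫ + [x = y]·⟪δ_u, A δ_v⟫`.
Resolvents `(B - z)⁻¹` are expressed as `Ring.inverse (B - z • 1)`, which agrees
with the resolvent whenever `z ∉ σ(B)`. -/
/-- The restriction of `φ ∈ ℓ²(Γ × G)` to the fibre over `x`, as a vector of `ℓ²(G)`. -/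
noncomputable def fibre {Γ G : Type*} [Fintype G] (x : Γ)
    (φ : lp (fun _ : Γ × G => ℂ) 2) : EuclideanSpace ℂ G :=
  WithLp.toLp 2 fun u => φ (x, u)

@[simp]
theorem fibre_apply {Γ G : Type*} [Fintype G] (x : Γ) (φ : lp (fun _ : Γ × G => ℂ) 2) (u : G) :
    fibre x φ u = φ (x, u) :=
  rfl

/-- On a vector vanishing on `Γ × {O}`, a decorated Hamiltonian acts fibrewise as `A`. -/
theorem fibre_decorated_apply
    {Γ : Type*} [DecidableEq Γ] {G : Type*} [Fintype G] [DecidableEq G] {O : G}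
    {Ho : lp (fun _ : Γ => ℂ) 2 →L[ℂ] lp (fun _ : Γ => ℂ) 2}
    {A : EuclideanSpace ℂ G →L[ℂ] EuclideanSpace ℂ G} (hA : IsSelfAdjoint A)
    {H : lp (fun _ : Γ × G => ℂ) 2 →L[ℂ] lp (fun _ : Γ × G => ℂ) 2} (hH : IsSelfAdjoint H)
    (hmat : ∀ (x y : Γ) (u v : G),
      ⟪lp.single 2 (x, u) (1 : ℂ), H (lp.single 2 (y, v) 1)⟫_ℂ
        = (if u = O then (1 : ℂ) else 0) * (if v = O then (1 : ℂ) else 0) *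
            ⟪lp.single 2 x (1 : ℂ), Ho (lp.single 2 y 1)⟫_ℂ
          + (if x = y then (1 : ℂ) else 0) *
            ⟪EuclideanSpace.single u (1 : ℂ), A (EuclideanSpace.single v 1)⟫_ℂ)
    {φ : lp (fun _ : Γ × G => ℂ) 2} (hφ : ∀ x, φ (x, O) = 0) (x : Γ) :
    fibre x (H φ) = A (fibre x φ) := by
  ext u
  have hentry (y : Γ) (v : G) :
      ⟪(H (lp.single 2 (x, u) 1) : lp (fun _ : Γ × G => ℂ) 2) (y, v), φ (y, v)⟫_ℂ =
        if y = x then ⟪A (EuclideanSpace.single u 1) v, fibre x φ v⟫_ℂ else 0 := by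
    have h := hmat y x v u
    rw [lp.inner_single_left] at h
    simp only [RCLike.inner_apply, map_one, mul_one, EuclideanSpace.inner_single_left,
      one_mul] at h
    by_cases hv : v = O
    · subst hv
      simp [hφ]
    · by_cases hy : y = x
      · subst hy
        simp [h, hv]
      · simp [h, hv, hy]
  have hsum : HasSum (fun p : Γ × G =>
      ⟪(H (lp.single 2 (x, u) 1) : lp (fun _ : Γ × G => ℂ) 2) p, φ p⟫_ℂ)
      (∑ v, ⟪A (EuclideanSpace.single u 1) v, fibre x φ v⟫_ℂ) := by
    have h := hasSum_sum_of_ne_finset_zero (L := .unconditional _) (f := fun p : Γ × G =>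
      ⟪(H (lp.single 2 (x, u) 1) : lp (fun _ : Γ × G => ℂ) 2) p, φ p⟫_ℂ)
      (s := ({x} : Finset Γ) ×ˢ Finset.univ) (by
        rintro ⟨y, v⟩ hp
        rw [hentry, if_neg (by simpa [eq_comm] using hp)])
    rw [Finset.sum_product, Finset.sum_singleton] at h
    simpa only [hentry, if_true] using h
  calc fibre x (H φ) u = ⟪lp.single 2 (x, u) (1 : ℂ), H φ⟫_ℂ := by
        rw [lp.inner_single_left]; simp
    _ = ⟪H (lp.single 2 (x, u) 1), φ⟫_ℂ := (hH.isSymmetric _ _).symm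
    _ = ⟪A (EuclideanSpace.single u 1), fibre x φ⟫_ℂ := by
        rw [PiLp.inner_apply]
        exact (lp.hasSum_inner _ _).unique hsum
    _ = ⟪EuclideanSpace.single u (1 : ℂ), A (fibre x φ)⟫_ℂ := hA.isSymmetric _ _
    _ = A (fibre x φ) u := by simp [EuclideanSpace.inner_single_left]

/-- If `δ_O` is a cyclic vector for `A`, i.e. the linear span of
`{A^k δ_O : k ∈ ℕ}` is all of `ℓ²(G)`, then the family `{δ_{(x,O)} : x ∈ Γ}` is
cyclic for `H`: the closed linear span of `{ H^k δ_{(x,O)} : k ∈ ℕ, x ∈ Γ }` equals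
`ℓ²(Γ × G)`. -/
theorem statement15
    {Γ : Type*} [Countable Γ] [Nonempty Γ] [DecidableEq Γ]
    {G : Type*} [Fintype G] [Nonempty G] [DecidableEq G]
    (O : G)
    (Ho : lp (fun _ : Γ => ℂ) 2 →L[ℂ] lp (fun _ : Γ => ℂ) 2)
    (hHo : IsSelfAdjoint Ho)
    (A : EuclideanSpace ℂ G →L[ℂ] EuclideanSpace ℂ G)
    (hA : IsSelfAdjoint A)
    (H : lp (fun _ : Γ × G => ℂ) 2 →L[ℂ] lp (fun _ : Γ × G => ℂ) 2)
    (hH : IsSelfAdjoint H)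
    (hmat : ∀ (x y : Γ) (u v : G),
      ⟪lp.single 2 (x, u) (1 : ℂ), H (lp.single 2 (y, v) 1)⟫_ℂ
        = (if u = O then (1 : ℂ) else 0) * (if v = O then (1 : ℂ) else 0) *
            ⟪lp.single 2 x (1 : ℂ), Ho (lp.single 2 y 1)⟫_ℂ
          + (if x = y then (1 : ℂ) else 0) *
            ⟪EuclideanSpace.single u (1 : ℂ), A (EuclideanSpace.single v 1)⟫_ℂ)
    (hcyc : Submodule.span ℂ
        (Set.range fun k : ℕ => (A ^ k) (EuclideanSpace.single O (1 : ℂ))) = ⊤) :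
    (Submodule.span ℂ
        (Set.range fun p : ℕ × Γ =>
          (H ^ p.1) (lp.single 2 (p.2, O) (1 : ℂ)))).topologicalClosure = ⊤ := by
  rw [Submodule.topologicalClosure_eq_top_iff, Submodule.eq_bot_iff]
  intro φ hφ
  have hHpow (k : ℕ) (x : Γ) : ((H ^ k) φ : lp (fun _ : Γ × G => ℂ) 2) (x, O) = 0 := by
    have h := (Submodule.mem_orthogonal _ _).1 hφ _ (Submodule.subset_span ⟨(k, x), rfl⟩)
    replace h := ((hH.pow k).isSymmetric _ _).symm.trans h
    rw [ContinuousLinearMap.coe_coe, lp.inner_single_left] at h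
    simpa using h
  have hfibre (k : ℕ) (x : Γ) : fibre x ((H ^ k) φ) = (A ^ k) (fibre x φ) := by
    induction k with
    | zero => simp
    | succ k ih =>
      rw [pow_succ', pow_succ', mul_apply_eq_comp, mul_apply_eq_comp,
        fibre_decorated_apply hA hH hmat (hHpow k), ih]
  have hzero (x : Γ) : fibre x φ = 0 := by
    have hmem : fibre x φ ∈ (Submodule.span ℂ
        (Set.range fun k : ℕ => (A ^ k) (EuclideanSpace.single O (1 : ℂ))))ᗮ := by
      rw [Submodule.mem_orthogonal]
      intro w hw
      induction hw using Submodule.span_induction with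
      | mem w hw =>
        obtain ⟨k, rfl⟩ := hw
        refine ((hA.pow k).isSymmetric _ _).trans ?_
        change ⟪_, (A ^ k) (fibre x φ)⟫_ℂ = 0
        rw [← hfibre, EuclideanSpace.inner_single_left, fibre_apply, hHpow, mul_zero]
      | zero => exact inner_zero_left _
      | add a b _ _ ha hb => rw [inner_add_left, ha, hb, add_zero]
      | smul c a _ ha => rw [inner_smul_left, ha, mul_zero]
    rwa [hcyc, Submodule.top_orthogonal_eq_bot, Submodule.mem_bot] at hmem
  ext ⟨x, u⟩
  exact congrArg (fun w : EuclideanSpace ℂ G => w u) (hzero x)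
end

section
/- Let d ≥ 1 and let H be the bounded self-adjoint operator on ℓ²(ℤ^d × {0,1}) defined by (Hψ)(x, 0) = Σ_{y : ‖y − x‖₁ = 1} (ψ(x,0) − ψ(y,0)) + ψ(x,0) − ψ(x,1) and (Hψ)(x, 1) = ψ(x,1) − ψ(x,0). Then σ(H) = [0, 1 + 2d − √(1 + 4d²)] ∪ [2, 1 + 2d + √(1 + 4d²)]. -/
/- `ℓ²(ℤ^d × {0,1})` is formalized as `lp (fun _ : (Fin d → ℤ) × Fin 2 => ℂ) 2`.
The `2d` nearest neighbors of `x ∈ ℤ^d` are exactly the points `x ± e_i`,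
`e_i = Pi.single i 1`, so
`Σ_{y : ‖y−x‖₁=1} (ψ(x,0) − ψ(y,0)) = Σ_i ((ψ(x,0) − ψ(x+e_i,0)) + (ψ(x,0) − ψ(x−e_i,0)))`.
`H` is the negative discrete Laplacian of `ℤ^d` decorated by a pendant vertex at
each site. -/

open Set Filter Topology

theorem memℓp_comp_perm {α : Type*} (σ : Equiv.Perm α) (ψ : lp (fun _ : α => ℂ) 2) :
    Memℓp (fun a => ψ (σ a)) 2 :=
  memℓp_gen (σ.summable_iff.mpr ((lp.memℓp ψ).summable (by norm_num)))

theorem norm_comp_perm {α : Type*} (σ : Equiv.Perm α) (ψ : lp (fun _ : α => ℂ) 2) :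
    ‖(⟨_, memℓp_comp_perm σ ψ⟩ : lp (fun _ : α => ℂ) 2)‖ = ‖ψ‖ := by
  rw [lp.norm_eq_tsum_rpow (by norm_num), lp.norm_eq_tsum_rpow (by norm_num)]
  congr 1
  exact σ.tsum_eq fun a => ‖ψ a‖ ^ (2 : ENNReal).toReal

theorem norm_mul_le_of_norm_le_one {z : ℂ} (hz : ‖z‖ ≤ 1) (w : ℂ) : ‖z * w‖ ≤ ‖w‖ := by
  rw [norm_mul]
  exact mul_le_of_le_one_left (norm_nonneg _) hz

/-- Composition with a permutation of the index set followed by multiplication by a weight bounded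
by one, as a linear map on `ℓ²`. -/
def weightedCompLinear {α : Type*} (c : α → ℂ) (hc : ∀ a, ‖c a‖ ≤ 1) (σ : Equiv.Perm α) :
    lp (fun _ : α => ℂ) 2 →ₗ[ℂ] lp (fun _ : α => ℂ) 2 where
  toFun ψ := ⟨fun a => c a * ψ (σ a),
    (memℓp_comp_perm σ ψ).mono' fun a => norm_mul_le_of_norm_le_one (hc a) _⟩
  map_add' φ ψ := by
    ext a
    exact mul_add _ _ _
  map_smul' z ψ := by
    ext a
    exact mul_left_comm _ _ _

theorem norm_weightedCompLinear_apply_le {α : Type*} (c : α → ℂ) (hc : ∀ a, ‖c a‖ ≤ 1)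
    (σ : Equiv.Perm α) (ψ : lp (fun _ : α => ℂ) 2) :
    ‖weightedCompLinear c hc σ ψ‖ ≤ 1 * ‖ψ‖ := by
  rw [one_mul, ← norm_comp_perm σ ψ]
  exact lp.norm_mono two_ne_zero fun a => norm_mul_le_of_norm_le_one (hc a) _

/-- The bounded operator underlying `weightedCompLinear`. -/
noncomputable def weightedComp {α : Type*} (c : α → ℂ) (hc : ∀ a, ‖c a‖ ≤ 1) (σ : Equiv.Perm α) :
    lp (fun _ : α => ℂ) 2 →L[ℂ] lp (fun _ : α => ℂ) 2 :=
  (weightedCompLinear c hc σ).mkContinuous 1 (norm_weightedCompLinear_apply_le c hc σ)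

@[simp]
theorem weightedComp_apply {α : Type*} (c : α → ℂ) (hc : ∀ a, ‖c a‖ ≤ 1) (σ : Equiv.Perm α)
    (ψ : lp (fun _ : α => ℂ) 2) (a : α) : weightedComp c hc σ ψ a = c a * ψ (σ a) := rfl

theorem norm_weightedComp_le {α : Type*} (c : α → ℂ) (hc : ∀ a, ‖c a‖ ≤ 1) (σ : Equiv.Perm α) :
    ‖weightedComp c hc σ‖ ≤ 1 :=
  LinearMap.mkContinuous_norm_le _ zero_le_one (norm_weightedCompLinear_apply_le c hc σ)

theorem star_weightedComp {α : Type*} (c : α → ℂ) (hc : ∀ a, ‖c a‖ ≤ 1) (σ : Equiv.Perm α) :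
    star (weightedComp c hc σ) =
      weightedComp (fun a => star (c (σ.symm a))) (fun a => by simpa using hc (σ.symm a))
        σ.symm := by
  rw [ContinuousLinearMap.star_eq_adjoint]
  symm
  rw [ContinuousLinearMap.eq_adjoint_iff]
  intro φ ψ
  rw [lp.inner_eq_tsum, lp.inner_eq_tsum, ← σ.tsum_eq]
  refine tsum_congr fun a => ?_
  simp
  ring

/-- The transposition of the two layers of `α × Fin 2`. -/
def layerSwap (α : Type*) : Equiv.Perm (α × Fin 2) := Equiv.prodCongr (Equiv.refl α) (Equiv.swap 0 1)

/-- The translation by `v` in both layers of `G × Fin 2`. -/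
def layerShift {G : Type*} [AddGroup G] (v : G) : Equiv.Perm (G × Fin 2) :=
  Equiv.prodCongr (Equiv.addRight v) (Equiv.refl _)

noncomputable section

/-- The swap of the two layers, as an operator on `ℓ²`. -/
def swapOp (α : Type*) : lp (fun _ : α × Fin 2 => ℂ) 2 →L[ℂ] lp (fun _ : α × Fin 2 => ℂ) 2 :=
  weightedComp (fun _ => 1) (by simp) (layerSwap α)

/-- The projection onto functions supported in the layer `0`. -/
def baseProj (α : Type*) : lp (fun _ : α × Fin 2 => ℂ) 2 →L[ℂ] lp (fun _ : α × Fin 2 => ℂ) 2 :=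
  weightedComp (fun a => if a.2 = 0 then 1 else 0) (fun a => by split_ifs <;> simp) 1

/-- The translation operator, acting in both layers. -/
def shiftOp {G : Type*} [AddGroup G] (v : G) :
    lp (fun _ : G × Fin 2 => ℂ) 2 →L[ℂ] lp (fun _ : G × Fin 2 => ℂ) 2 :=
  weightedComp (fun _ => 1) (by simp) (layerShift v)

/-- The adjacency operator of `ℤ^d`, acting in both layers. -/
def adjOp (d : ℕ) :
    lp (fun _ : (Fin d → ℤ) × Fin 2 => ℂ) 2 →L[ℂ] lp (fun _ : (Fin d → ℤ) × Fin 2 => ℂ) 2 :=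
  ∑ i : Fin d, (shiftOp (Pi.single i 1) + shiftOp (-Pi.single i 1))

/-- The negative Laplacian of the decorated lattice. -/
def decoratedLaplacian (d : ℕ) :
    lp (fun _ : (Fin d → ℤ) × Fin 2 => ℂ) 2 →L[ℂ] lp (fun _ : (Fin d → ℤ) × Fin 2 => ℂ) 2 :=
  baseProj _ * ((2 * d : ℂ) • 1 - adjOp d) + 1 - swapOp _

end

@[simp]
theorem swapOp_apply_zero {α : Type*} (ψ : lp (fun _ : α × Fin 2 => ℂ) 2) (x : α) :
    swapOp α ψ (x, 0) = ψ (x, 1) := by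
  simp [swapOp, layerSwap]

@[simp]
theorem swapOp_apply_one {α : Type*} (ψ : lp (fun _ : α × Fin 2 => ℂ) 2) (x : α) :
    swapOp α ψ (x, 1) = ψ (x, 0) := by
  simp [swapOp, layerSwap]

@[simp]
theorem baseProj_apply_zero {α : Type*} (ψ : lp (fun _ : α × Fin 2 => ℂ) 2) (x : α) :
    baseProj α ψ (x, 0) = ψ (x, 0) := by
  simp [baseProj]

@[simp]
theorem baseProj_apply_one {α : Type*} (ψ : lp (fun _ : α × Fin 2 => ℂ) 2) (x : α) :
    baseProj α ψ (x, 1) = 0 := by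
  simp [baseProj]

@[simp]
theorem shiftOp_apply {G : Type*} [AddGroup G] (v : G) (ψ : lp (fun _ : G × Fin 2 => ℂ) 2)
    (x : G) (k : Fin 2) : shiftOp v ψ (x, k) = ψ (x + v, k) := by
  simp [shiftOp, layerShift]

theorem lp_layer_ext {α : Type*} {φ ψ : lp (fun _ : α × Fin 2 => ℂ) 2}
    (h0 : ∀ x, φ (x, 0) = ψ (x, 0)) (h1 : ∀ x, φ (x, 1) = ψ (x, 1)) : φ = ψ := by
  ext ⟨x, k⟩
  fin_cases k
  exacts [h0 x, h1 x]

theorem baseProj_mul_self (α : Type*) : baseProj α * baseProj α = baseProj α :=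
  ContinuousLinearMap.ext fun ψ => lp_layer_ext (by simp) (by simp)

theorem swapOp_mul_self (α : Type*) : swapOp α * swapOp α = 1 :=
  ContinuousLinearMap.ext fun ψ => lp_layer_ext (by simp) (by simp)

theorem baseProj_mul_swapOp_add (α : Type*) :
    baseProj α * swapOp α + swapOp α * baseProj α = swapOp α :=
  ContinuousLinearMap.ext fun ψ => lp_layer_ext (by simp) (by simp)

theorem commute_shiftOp_baseProj {G : Type*} [AddGroup G] (v : G) :
    Commute (shiftOp v) (baseProj G) :=
  ContinuousLinearMap.ext fun ψ => lp_layer_ext (by simp) (by simp)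

theorem commute_shiftOp_swapOp {G : Type*} [AddGroup G] (v : G) :
    Commute (shiftOp v) (swapOp G) :=
  ContinuousLinearMap.ext fun ψ => lp_layer_ext (by simp) (by simp)

theorem commute_adjOp_baseProj (d : ℕ) : Commute (adjOp d) (baseProj _) :=
  Commute.sum_left _ _ _ fun _ _ =>
    (commute_shiftOp_baseProj _).add_left (commute_shiftOp_baseProj _)

theorem commute_adjOp_swapOp (d : ℕ) : Commute (adjOp d) (swapOp _) :=
  Commute.sum_left _ _ _ fun _ _ =>
    (commute_shiftOp_swapOp _).add_left (commute_shiftOp_swapOp _)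

theorem isSelfAdjoint_baseProj (α : Type*) : IsSelfAdjoint (baseProj α) := by
  rw [IsSelfAdjoint, baseProj, star_weightedComp]
  congr 1
  ext a
  simp only [Equiv.Perm.one_def, Equiv.refl_symm, Equiv.refl_apply]
  by_cases h : a.2 = 0 <;> simp [h]

theorem isSelfAdjoint_swapOp (α : Type*) : IsSelfAdjoint (swapOp α) := by
  rw [IsSelfAdjoint, swapOp, star_weightedComp]
  simp [layerSwap]

theorem star_shiftOp {G : Type*} [AddGroup G] (v : G) : star (shiftOp v) = shiftOp (-v) := by
  rw [shiftOp, star_weightedComp]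
  simp [shiftOp, layerShift]

theorem isSelfAdjoint_adjOp (d : ℕ) : IsSelfAdjoint (adjOp d) := by
  simp [IsSelfAdjoint, adjOp, star_shiftOp, add_comm]

theorem norm_adjOp_le (d : ℕ) : ‖adjOp d‖ ≤ 2 * d := by
  have h (v : Fin d → ℤ) : ‖shiftOp v‖ ≤ 1 := norm_weightedComp_le _ _ _
  calc ‖adjOp d‖ ≤ ∑ _i : Fin d, (2 : ℝ) :=
        norm_sum_le_of_le _ fun i _ => (norm_add_le _ _).trans
          ((add_le_add (h _) (h _)).trans_eq one_add_one_eq_two)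
    _ = 2 * d := by simp [mul_comm]

theorem isSelfAdjoint_decoratedLaplacian (d : ℕ) : IsSelfAdjoint (decoratedLaplacian d) := by
  have hL : IsSelfAdjoint ((2 * d : ℂ) • (1 : lp (fun _ : (Fin d → ℤ) × Fin 2 => ℂ) 2 →L[ℂ]
      lp (fun _ : (Fin d → ℤ) × Fin 2 => ℂ) 2) - adjOp d) := by
    simp [IsSelfAdjoint, (isSelfAdjoint_adjOp d).star_eq]
  refine (((isSelfAdjoint_baseProj _).commute_iff hL).mp ?_ |>.add (.one _)).sub
    (isSelfAdjoint_swapOp _)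
  exact (((Commute.one_left _).smul_left _).sub_left (commute_adjOp_baseProj d)).symm

theorem lp_add_apply {α : Type*} (φ ψ : lp (fun _ : α => ℂ) 2) (a : α) :
    (φ + ψ) a = φ a + ψ a := rfl

theorem lp_sub_apply {α : Type*} (φ ψ : lp (fun _ : α => ℂ) 2) (a : α) :
    (φ - ψ) a = φ a - ψ a := rfl

theorem lp_smul_apply {α : Type*} (z : ℂ) (ψ : lp (fun _ : α => ℂ) 2) (a : α) :
    (z • ψ) a = z * ψ a := rfl

theorem lp_sum_apply {α ι : Type*} (s : Finset ι) (f : ι → lp (fun _ : α => ℂ) 2) (a : α) :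
    (∑ i ∈ s, f i) a = ∑ i ∈ s, f i a :=
  map_sum (lp.evalₗ (𝕜 := ℂ) (fun _ : α => ℂ) 2 a) f s

theorem adjOp_apply {d : ℕ} (ψ : lp (fun _ : (Fin d → ℤ) × Fin 2 => ℂ) 2) (x : Fin d → ℤ)
    (k : Fin 2) :
    adjOp d ψ (x, k) = ∑ i, (ψ (x + Pi.single i 1, k) + ψ (x - Pi.single i 1, k)) := by
  simp only [adjOp, sum_apply, add_apply, lp_sum_apply,
    lp_add_apply, shiftOp_apply, sub_eq_add_neg]

theorem decoratedLaplacian_apply_zero {d : ℕ} (ψ : lp (fun _ : (Fin d → ℤ) × Fin 2 => ℂ) 2)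
    (x : Fin d → ℤ) :
    decoratedLaplacian d ψ (x, 0) = (∑ i : Fin d,
      ((ψ (x, 0) - ψ (x + Pi.single i 1, 0)) + (ψ (x, 0) - ψ (x - Pi.single i 1, 0))))
        + ψ (x, 0) - ψ (x, 1) := by
  simp [decoratedLaplacian, -lp.coeFn_sub, -lp.coeFn_add, -lp.coeFn_smul, lp_sub_apply,
    lp_add_apply, lp_smul_apply, adjOp_apply, Finset.sum_add_distrib]
  ring

theorem decoratedLaplacian_apply_one {d : ℕ} (ψ : lp (fun _ : (Fin d → ℤ) × Fin 2 => ℂ) 2)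
    (x : Fin d → ℤ) : decoratedLaplacian d ψ (x, 1) = ψ (x, 1) - ψ (x, 0) := by
  simp [decoratedLaplacian, -lp.coeFn_sub, -lp.coeFn_add, -lp.coeFn_smul, lp_sub_apply,
    lp_add_apply, lp_smul_apply]

theorem mul_self_eq_of_projection_of_reflection {R : Type*} [Ring R] {P S L : R} (hP : P * P = P)
    (hS : S * S = 1) (hPS : P * S + S * P = S) (hLP : L * P = P * L) (hLS : L * S = S * L) :
    (P * L + 1 - S) * (P * L + 1 - S) =
      P * L + 1 - S + (P * L + 1 - S) + L * (P * L + 1 - S) - L := by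
  linear_combination (norm := noncomm_ring)
    P * hLP * L + hP * L * L - P * hLS - hPS * L + hS - hLP * L + hLS

theorem decoratedLaplacian_factor (d : ℕ) (z : ℂ) :
    ∃ Y, Commute (algebraMap ℂ _ z - decoratedLaplacian d) Y ∧
      (algebraMap ℂ _ z - decoratedLaplacian d) * Y =
        algebraMap ℂ _ (z * (2 - z) - (1 - z) * (2 * d)) + (1 - z) • adjOp d := by
  set L : lp (fun _ : (Fin d → ℤ) × Fin 2 => ℂ) 2 →L[ℂ] lp (fun _ : (Fin d → ℤ) × Fin 2 => ℂ) 2 :=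
    (2 * d : ℂ) • 1 - adjOp d with hL
  have hLP : Commute L (baseProj _) :=
    ((Commute.one_left _).smul_left _).sub_left (commute_adjOp_baseProj d)
  have hLS : Commute L (swapOp _) :=
    ((Commute.one_left _).smul_left _).sub_left (commute_adjOp_swapOp d)
  have hLH : Commute L (decoratedLaplacian d) :=
    ((hLP.mul_right (.refl _)).add_right (.one_right _)).sub_right hLS
  have hH : decoratedLaplacian d * decoratedLaplacian d =
      decoratedLaplacian d + decoratedLaplacian d + L * decoratedLaplacian d - L :=
    mul_self_eq_of_projection_of_reflection (baseProj_mul_self _) (swapOp_mul_self _)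
      (baseProj_mul_swapOp_add _) hLP hLS
  set H := decoratedLaplacian d
  have hzH : Commute (algebraMap ℂ _ z) H := Algebra.commutes z H
  have hzL : Commute (algebraMap ℂ _ z) L := Algebra.commutes z L
  refine ⟨2 + L - H - algebraMap ℂ _ z, ?_, ?_⟩
  · have h2 (X : lp (fun _ : (Fin d → ℤ) × Fin 2 => ℂ) 2 →L[ℂ]
        lp (fun _ : (Fin d → ℤ) × Fin 2 => ℂ) 2) : Commute X 2 := Commute.ofNat_right X 2
    exact ((((h2 _).add_right hzL).sub_right hzH).sub_right (.refl _)).sub_left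
      ((((h2 _).add_right hLH.symm).sub_right (.refl _)).sub_right hzH.symm)
  · have hA : adjOp d = algebraMap ℂ _ (2 * d : ℂ) - L := by
      rw [hL, Algebra.algebraMap_eq_smul_one]
      abel
    rw [hA, Algebra.smul_def]
    simp only [map_sub, map_mul, map_ofNat, map_one]
    linear_combination (norm := noncomm_ring) hH + hLH.eq - hzH.eq

theorem spectrum_decoratedLaplacian_subset {d : ℕ} {t : ℝ}
    (ht : (t : ℂ) ∈ spectrum ℂ (decoratedLaplacian d)) :
    t ≠ 1 ∧ |2 * d - t * (2 - t) / (1 - t)| ≤ 2 * d := by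
  obtain ⟨Y, hcomm, hmul⟩ := decoratedLaplacian_factor d t
  have hunit : ¬ IsUnit (algebraMap ℂ _ ((t : ℂ) * (2 - t) - (1 - t) * (2 * d)) +
      (1 - t : ℂ) • adjOp d) := by
    rw [← hmul, hcomm.isUnit_mul_iff]
    exact fun h => ht h.1
  have ht1 : t ≠ 1 := by
    rintro rfl
    apply hunit
    norm_num
  refine ⟨ht1, ?_⟩
  have ht1' : (1 - t : ℂ) ≠ 0 := by
    rw [sub_ne_zero]
    exact_mod_cast ht1.symm
  have hmem : ((2 * d - t * (2 - t) / (1 - t) : ℝ) : ℂ) ∈ spectrum ℂ (adjOp d) := by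
    rw [spectrum.mem_iff]
    intro h
    apply hunit
    have := h.smul (Units.mk0 (-(1 - t : ℂ)) (neg_ne_zero.mpr ht1'))
    convert this using 1
    simp only [Units.smul_def, Units.val_mk0, smul_sub, Algebra.algebraMap_eq_smul_one, smul_smul,
      neg_smul, sub_neg_eq_add]
    congr 2
    push_cast
    field_simp
    ring
  have := spectrum.norm_le_norm_mul_of_mem hmem
  rw [Complex.norm_real, Real.norm_eq_abs] at this
  exact (this.trans (mul_le_of_le_one_right (norm_nonneg _) ContinuousLinearMap.norm_id_le)).trans
    (norm_adjOp_le d)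

theorem summable_int_exp_neg_mul_abs {ε : ℝ} (hε : 0 < ε) :
    Summable fun n : ℤ => Real.exp (-ε * |(n : ℝ)|) := by
  have h : Summable fun n : ℕ => Real.exp (n * -ε) :=
    Real.summable_exp_nat_mul_iff.mpr (neg_neg_of_pos hε)
  refine .of_nat_of_neg ?_ ?_ <;> refine h.congr fun n => ?_ <;> simp [mul_comm]

theorem summable_exp_neg_mul_sum_abs {ε : ℝ} (hε : 0 < ε) (d : ℕ) :
    Summable fun x : Fin d → ℤ => Real.exp (-ε * ∑ i, |(x i : ℝ)|) := by
  induction d with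
  | zero => exact Summable.of_finite
  | succ d ih =>
    rw [← (Fin.consEquiv fun _ => ℤ).summable_iff]
    refine ((summable_int_exp_neg_mul_abs hε).mul_of_nonneg ih (fun _ => (Real.exp_pos _).le)
      fun _ => (Real.exp_pos _).le).congr fun y => ?_
    simp [Fin.consEquiv, Fin.sum_univ_succ, mul_add, Real.exp_add]

/-- A plane wave of wave number `k` in every coordinate, damped at rate `ε`. -/
noncomputable def dampedWave {d : ℕ} (k ε : ℝ) (x : Fin d → ℤ) : ℂ :=
  Real.exp (-ε * ∑ i, |(x i : ℝ)|) * Complex.exp (k * (∑ i, (x i : ℝ) : ℝ) * Complex.I)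

theorem norm_dampedWave {d : ℕ} (k ε : ℝ) (x : Fin d → ℤ) :
    ‖dampedWave k ε x‖ = Real.exp (-ε * ∑ i, |(x i : ℝ)|) := by
  rw [dampedWave, norm_mul, ← Complex.ofReal_mul, Complex.norm_exp_ofReal_mul_I, mul_one,
    Complex.norm_real, Real.norm_eq_abs, abs_of_pos (Real.exp_pos _)]

theorem abs_exp_sub_one_le_of_abs_le {a ε : ℝ} (h : |a| ≤ ε) :
    |Real.exp a - 1| ≤ Real.exp ε - 1 := by
  rw [abs_le] at h ⊢
  have h1 : Real.exp (-ε) ≤ Real.exp a := Real.exp_le_exp.mpr h.1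
  have h2 : Real.exp a ≤ Real.exp ε := Real.exp_le_exp.mpr h.2
  have h3 := Real.add_one_le_exp ε
  have h4 := Real.add_one_le_exp (-ε)
  constructor <;> linarith

theorem norm_dampedWave_add_single_sub_le {d : ℕ} (k : ℝ) {ε : ℝ} (hε : 0 ≤ ε) (x : Fin d → ℤ)
    (i : Fin d) {n : ℤ} (hn : |(n : ℝ)| = 1) :
    ‖dampedWave k ε (x + Pi.single i n) - Complex.exp (k * n * Complex.I) * dampedWave k ε x‖ ≤
      (Real.exp ε - 1) * ‖dampedWave k ε x‖ := by
  set m := ∑ j, |(x j : ℝ)| with hm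
  set m' := ∑ j, |((x + Pi.single i n : Fin d → ℤ) j : ℝ)| with hm'
  have hsum : ∑ j, ((x + Pi.single i n : Fin d → ℤ) j : ℝ) = ∑ j, (x j : ℝ) + n := by
    simp only [Pi.add_apply, Int.cast_add, Finset.sum_add_distrib]
    congr 1
    rw [← Int.cast_sum, Finset.sum_pi_single']
    simp
  have hmm : |m' - m| ≤ 1 := by
    calc |m' - m| ≤ ∑ j, |((Pi.single i n : Fin d → ℤ) j : ℝ)| := by
          rw [← Finset.sum_sub_distrib]
          refine (Finset.abs_sum_le_sum_abs _ _).trans (Finset.sum_le_sum fun j _ => ?_)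
          refine (abs_abs_sub_abs_le _ _).trans_eq ?_
          simp
      _ = 1 := by
          rw [Finset.sum_eq_single i]
          · simpa using hn
          · intro j _ hj
            simp [hj]
          · simp
  have hfac : dampedWave k ε (x + Pi.single i n) -
      Complex.exp (k * n * Complex.I) * dampedWave k ε x =
      Complex.exp (k * n * Complex.I) * dampedWave k ε x * (Real.exp (-ε * (m' - m)) - 1 : ℝ) := by
    have h1 : dampedWave k ε (x + Pi.single i n) = Complex.exp (k * n * Complex.I) *
        dampedWave k ε x * (Real.exp (-ε * (m' - m)) : ℝ) := by
      simp only [dampedWave, hsum, ← hm, ← hm', Complex.ofReal_exp]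
      simp only [← Complex.exp_add]
      congr 1
      push_cast
      ring
    rw [h1]
    push_cast
    ring
  rw [hfac, norm_mul, norm_mul, ← Complex.ofReal_intCast, ← Complex.ofReal_mul,
    Complex.norm_exp_ofReal_mul_I, one_mul, mul_comm, Complex.norm_real, Real.norm_eq_abs]
  refine mul_le_mul_of_nonneg_right (abs_exp_sub_one_le_of_abs_le ?_) (norm_nonneg _)
  rw [abs_mul, abs_neg, abs_of_nonneg hε]
  exact mul_le_of_le_one_right hε hmm

theorem norm_sum_dampedWave_sub_le {d : ℕ} (k : ℝ) {ε : ℝ} (hε : 0 ≤ ε) (x : Fin d → ℤ) :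
    ‖∑ i, (dampedWave k ε (x + Pi.single i 1) + dampedWave k ε (x - Pi.single i 1)) -
        2 * d * Real.cos k * dampedWave k ε x‖ ≤
      2 * d * (Real.exp ε - 1) * ‖dampedWave k ε x‖ := by
  have hrw : ∑ i, (dampedWave k ε (x + Pi.single i 1) + dampedWave k ε (x - Pi.single i 1)) -
        2 * d * Real.cos k * dampedWave k ε x =
      ∑ i, ((dampedWave k ε (x + Pi.single i 1) -
          Complex.exp (k * (1 : ℤ) * Complex.I) * dampedWave k ε x) +
        (dampedWave k ε (x + Pi.single i (-1)) -
          Complex.exp (k * (-1 : ℤ) * Complex.I) * dampedWave k ε x)) := by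
    simp only [Finset.sum_add_distrib, Finset.sum_sub_distrib, Finset.sum_const, Finset.card_univ,
      Fintype.card_fin, nsmul_eq_mul, Complex.ofReal_cos, Complex.cos, Pi.single_neg,
      ← sub_eq_add_neg]
    push_cast
    ring_nf
  rw [hrw]
  refine (norm_sum_le_of_le _ fun i _ => (norm_add_le _ _).trans (add_le_add
    (norm_dampedWave_add_single_sub_le k hε x i (by simp))
    (norm_dampedWave_add_single_sub_le k hε x i (by simp)))).trans_eq ?_
  simp
  ring

theorem memℓp_dampedWave {d : ℕ} (k : ℝ) {ε : ℝ} (hε : 0 < ε) (c : Fin 2 → ℂ) :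
    Memℓp (fun a : (Fin d → ℤ) × Fin 2 => dampedWave k ε a.1 * c a.2) 2 := by
  refine memℓp_gen (((summable_exp_neg_mul_sum_abs (mul_pos two_pos hε) d).mul_of_nonneg
    (Summable.of_finite (f := fun j => ‖c j‖ ^ 2)) (fun _ => (Real.exp_pos _).le)
    fun _ => by positivity).congr fun a => ?_)
  rw [norm_mul, norm_dampedWave, ENNReal.toReal_ofNat, Real.rpow_two, mul_pow, ← Real.exp_nat_mul]
  push_cast
  ring_nf

theorem norm_decoratedLaplacian_sub_dampedWave_le {d : ℕ} {k t ε : ℝ} (hε : 0 < ε) (ht1 : t ≠ 1)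
    (ht : t * (2 - t) / (1 - t) = 2 * d * (1 - Real.cos k)) :
    ∃ ψ : lp (fun _ : (Fin d → ℤ) × Fin 2 => ℂ) 2, ψ ≠ 0 ∧
      ‖(algebraMap ℂ (lp (fun _ : (Fin d → ℤ) × Fin 2 => ℂ) 2 →L[ℂ]
        lp (fun _ : (Fin d → ℤ) × Fin 2 => ℂ) 2) t - decoratedLaplacian d) ψ‖ ≤
        2 * d * (Real.exp ε - 1) * ‖ψ‖ := by
  have ht1' : (1 - t : ℂ) ≠ 0 := by
    rw [sub_ne_zero]
    exact_mod_cast ht1.symm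
  have hexp : 0 ≤ 2 * d * (Real.exp ε - 1) :=
    mul_nonneg (by positivity) (by linarith [Real.add_one_le_exp ε])
  let ψ : lp (fun _ : (Fin d → ℤ) × Fin 2 => ℂ) 2 :=
    ⟨_, memℓp_dampedWave k hε ![1, (1 - t : ℂ)⁻¹]⟩
  have hψ0 (x : Fin d → ℤ) : ψ (x, 0) = dampedWave k ε x := mul_one _
  have hψ1 (x : Fin d → ℤ) : ψ (x, 1) = dampedWave k ε x * (1 - t : ℂ)⁻¹ := rfl
  refine ⟨ψ, fun h => ?_, ?_⟩
  · have h0 : ψ (0, 0) = 0 := by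
      rw [h]
      rfl
    have := norm_dampedWave (d := d) k ε 0
    rw [← hψ0, h0, norm_zero] at this
    exact (Real.exp_pos _).ne this
  · have hnorm : ‖((2 * d * (Real.exp ε - 1) : ℝ) : ℂ) • ψ‖ = 2 * d * (Real.exp ε - 1) * ‖ψ‖ := by
      rw [norm_smul, Complex.norm_real, Real.norm_eq_abs, abs_of_nonneg hexp]
    rw [← hnorm]
    refine lp.norm_mono two_ne_zero ?_
    rintro ⟨x, j⟩
    rw [Algebra.algebraMap_eq_smul_one, sub_apply, smul_apply,
      one_apply_eq_self, lp_sub_apply, lp_smul_apply, lp_smul_apply, norm_mul,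
      Complex.norm_real, Real.norm_eq_abs, abs_of_nonneg hexp]
    fin_cases j
    · change ‖(t : ℂ) * ψ (x, 0) - decoratedLaplacian d ψ (x, 0)‖ ≤ _ * ‖ψ (x, 0)‖
      rw [hψ0 x]
      refine le_of_eq_of_le ?_ (norm_sum_dampedWave_sub_le k hε.le x)
      congr 1
      have ht' : (t * (2 - t) / (1 - t) : ℂ) = 2 * d * (1 - Real.cos k) := by exact_mod_cast ht
      have hcos : (2 * d * Real.cos k : ℂ) = 2 * d - t * (2 - t) / (1 - t) := by
        rw [ht']
        ring
      rw [decoratedLaplacian_apply_zero, hcos]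
      simp only [hψ0, hψ1, Finset.sum_add_distrib, Finset.sum_sub_distrib, Finset.sum_const,
        Finset.card_univ, Fintype.card_fin, nsmul_eq_mul]
      field_simp
      ring
    · change ‖(t : ℂ) * ψ (x, 1) - decoratedLaplacian d ψ (x, 1)‖ ≤ _ * ‖ψ (x, 1)‖
      have : (t : ℂ) * ψ (x, 1) - decoratedLaplacian d ψ (x, 1) = 0 := by
        rw [decoratedLaplacian_apply_one, hψ0, hψ1]
        field_simp
        ring
      rw [this, norm_zero]
      positivity

theorem mem_spectrum_decoratedLaplacian {d : ℕ} {k t : ℝ} (ht1 : t ≠ 1)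
    (ht : t * (2 - t) / (1 - t) = 2 * d * (1 - Real.cos k)) :
    (t : ℂ) ∈ spectrum ℂ (decoratedLaplacian d) := by
  rw [spectrum.mem_iff]
  intro hunit
  obtain ⟨R, hR⟩ := hunit.exists_left_inv
  have hbound : ∀ ε > 0, 1 ≤ ‖R‖ * (2 * d * (Real.exp ε - 1)) := by
    intro ε hε
    obtain ⟨ψ, hψ, hle⟩ := norm_decoratedLaplacian_sub_dampedWave_le hε ht1 ht
    refine le_of_mul_le_mul_right ?_ (norm_pos_iff.mpr hψ)
    calc 1 * ‖ψ‖ = ‖(R * (algebraMap ℂ _ (t : ℂ) - decoratedLaplacian d)) ψ‖ := by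
          rw [hR, one_mul, one_apply_eq_self]
      _ ≤ ‖R‖ * (2 * d * (Real.exp ε - 1) * ‖ψ‖) :=
          (R.le_opNorm _).trans (mul_le_mul_of_nonneg_left hle (norm_nonneg _))
      _ = ‖R‖ * (2 * d * (Real.exp ε - 1)) * ‖ψ‖ := by ring
  have hcont : Continuous fun ε : ℝ => ‖R‖ * (2 * d * (Real.exp ε - 1)) := by fun_prop
  have hlim := (hcont.tendsto 0).mono_left (nhdsWithin_le_nhds (s := Ioi 0))
  have := ge_of_tendsto hlim (eventually_mem_nhdsWithin.mono hbound)
  norm_num at this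

theorem abs_sub_le_iff_mem_bands {D t : ℝ} (hD : 0 < D) :
    t ≠ 1 ∧ |2 * D - t * (2 - t) / (1 - t)| ≤ 2 * D ↔
      t ∈ Icc 0 (1 + 2 * D - √(1 + 4 * D ^ 2)) ∪ Icc 2 (1 + 2 * D + √(1 + 4 * D ^ 2)) := by
  have hsq : √(1 + 4 * D ^ 2) ^ 2 = 1 + 4 * D ^ 2 := Real.sq_sqrt (by positivity)
  have hlt : 2 * D < √(1 + 4 * D ^ 2) := Real.lt_sqrt_of_sq_lt (by linarith)
  set r := √(1 + 4 * D ^ 2)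
  have habs : |2 * D - t * (2 - t) / (1 - t)| ≤ 2 * D ↔
      0 ≤ t * (2 - t) / (1 - t) ∧ t * (2 - t) / (1 - t) ≤ 4 * D := by
    rw [abs_le]
    constructor <;> rintro ⟨h1, h2⟩ <;> constructor <;> linarith
  rw [habs, mem_union, mem_Icc, mem_Icc]
  constructor
  · rintro ⟨h1, h2, h3⟩
    rcases lt_or_gt_of_ne h1 with h | h
    · left
      have hpos : 0 < 1 - t := by linarith
      rw [le_div_iff₀ hpos, zero_mul] at h2
      rw [div_le_iff₀ hpos] at h3
      constructor
      · nlinarith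
      · nlinarith
    · right
      have hneg : 1 - t < 0 := by linarith
      rw [le_div_iff_of_neg hneg, zero_mul] at h2
      rw [div_le_iff_of_neg hneg] at h3
      constructor
      · nlinarith
      · nlinarith
  · rintro (⟨h1, h2⟩ | ⟨h1, h2⟩)
    · have hpos : 0 < 1 - t := by linarith
      rw [div_le_iff₀ hpos]
      exact ⟨by linarith, div_nonneg (mul_nonneg h1 (by linarith)) hpos.le, by nlinarith⟩
    · have hneg : 1 - t < 0 := by linarith
      rw [div_le_iff_of_neg hneg]
      exact ⟨by linarith, div_nonneg_of_nonpos (by nlinarith) hneg.le, by nlinarith⟩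

theorem spectrum_decoratedLaplacian {d : ℕ} (hd : 1 ≤ d) :
    spectrum ℂ (decoratedLaplacian d) = (fun t : ℝ => (t : ℂ)) ''
      (Icc (0 : ℝ) (1 + 2 * d - √(1 + 4 * d ^ 2)) ∪
        Icc (2 : ℝ) (1 + 2 * d + √(1 + 4 * d ^ 2))) := by
  have hD : (0 : ℝ) < d := by exact_mod_cast hd
  ext z
  constructor
  · intro hz
    have hre := (isSelfAdjoint_decoratedLaplacian d).mem_spectrum_eq_re hz
    rw [hre] at hz
    exact ⟨z.re, (abs_sub_le_iff_mem_bands hD).mp (spectrum_decoratedLaplacian_subset hz),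
      hre.symm⟩
  · rintro ⟨t, ht, rfl⟩
    obtain ⟨ht1, ht⟩ := (abs_sub_le_iff_mem_bands hD).mpr ht
    rw [abs_le] at ht
    refine mem_spectrum_decoratedLaplacian
      (k := Real.arccos (1 - t * (2 - t) / (1 - t) / (2 * d))) ht1 ?_
    rw [Real.cos_arccos]
    · field_simp
      ring
    · have : t * (2 - t) / (1 - t) / (2 * d) ≤ 2 := by
        rw [div_le_iff₀ (by positivity)]
        linarith
      linarith
    · have : 0 ≤ t * (2 - t) / (1 - t) / (2 * d) := div_nonneg (by linarith) (by positivity)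
      linarith

/-- Let `d ≥ 1` and let `H` be the bounded self-adjoint operator
on `ℓ²(ℤ^d × {0,1})` defined by
`(Hψ)(x,0) = Σ_{y : ‖y−x‖₁=1} (ψ(x,0) − ψ(y,0)) + ψ(x,0) − ψ(x,1)` and
`(Hψ)(x,1) = ψ(x,1) − ψ(x,0)`.  Then `H` exists as a bounded operator, and any
bounded operator satisfying these formulas is self-adjoint with
`σ(H) = [0, 1 + 2d − √(1 + 4d²)] ∪ [2, 1 + 2d + √(1 + 4d²)]`. -/
theorem statement17 (d : ℕ) (hd : 1 ≤ d) :
    (∃ H : lp (fun _ : (Fin d → ℤ) × Fin 2 => ℂ) 2 →L[ℂ]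
        lp (fun _ : (Fin d → ℤ) × Fin 2 => ℂ) 2,
      ∀ (ψ : lp (fun _ : (Fin d → ℤ) × Fin 2 => ℂ) 2) (x : Fin d → ℤ),
        (H ψ) (x, 0) = (∑ i : Fin d,
            ((ψ (x, 0) - ψ (x + Pi.single i 1, 0)) +
             (ψ (x, 0) - ψ (x - Pi.single i 1, 0))))
          + ψ (x, 0) - ψ (x, 1) ∧
        (H ψ) (x, 1) = ψ (x, 1) - ψ (x, 0)) ∧
    (∀ H : lp (fun _ : (Fin d → ℤ) × Fin 2 => ℂ) 2 →L[ℂ]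
        lp (fun _ : (Fin d → ℤ) × Fin 2 => ℂ) 2,
      (∀ (ψ : lp (fun _ : (Fin d → ℤ) × Fin 2 => ℂ) 2) (x : Fin d → ℤ),
        (H ψ) (x, 0) = (∑ i : Fin d,
            ((ψ (x, 0) - ψ (x + Pi.single i 1, 0)) +
             (ψ (x, 0) - ψ (x - Pi.single i 1, 0))))
          + ψ (x, 0) - ψ (x, 1) ∧
        (H ψ) (x, 1) = ψ (x, 1) - ψ (x, 0)) →
      IsSelfAdjoint H ∧
      spectrum ℂ H = (fun t : ℝ => (t : ℂ)) ''
        (Set.Icc (0 : ℝ) (1 + 2 * d - Real.sqrt (1 + 4 * d ^ 2)) ∪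
         Set.Icc (2 : ℝ) (1 + 2 * d + Real.sqrt (1 + 4 * d ^ 2)))) := by
  refine ⟨⟨decoratedLaplacian d, fun ψ x =>
    ⟨decoratedLaplacian_apply_zero ψ x, decoratedLaplacian_apply_one ψ x⟩⟩, fun H hH => ?_⟩
  obtain rfl : H = decoratedLaplacian d := ContinuousLinearMap.ext fun ψ => lp_layer_ext
    (fun x => (hH ψ x).1.trans (decoratedLaplacian_apply_zero ψ x).symm)
    (fun x => (hH ψ x).2.trans (decoratedLaplacian_apply_one ψ x).symm)
  exact ⟨isSelfAdjoint_decoratedLaplacian d, spectrum_decoratedLaplacian hd⟩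
end
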